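/- arXiv:2311.16255 — 3 statements merged into one kernel-verified Lean document; each statement's English description precedes it below -/
import Mathlib

section
/- For every ε > 0 there exists a constant C = C(ε) > 0 with the following property. For every squarefree positive integer N, every positive divisor ℓ of N, every g ∈ SL₂(ℝ), every δ ∈ (0,1] and every L > 0, the set R(ℓ;g)⁰ ∩ Ψ(δ,L) is finite and has cardinality at most C·(N(1+L))^ε · (1 + (ℓ^{1/2} + ℓ·H(g)·δ^{1/2})·L + (ℓ^{3/2}·N^{−1/2} + ℓ^{3/2}·H(g)·δ^{1/2})·L² + (ℓ²/N)·δ^{1/2}·L³). -/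
open MeasureTheory Real Matrix Set

noncomputable section

/-- 2×2 real matrices. -/
abbrev M2 := Matrix (Fin 2) (Fin 2) ℝ

/-- The lattice R(ℓ) = { (a, b; c, d) : a, d ∈ ℤ, b ∈ (1/ℓ)ℤ, c ∈ (N/ℓ)ℤ }. -/
def Rlat (N ℓ : ℕ) : Set M2 :=
  {γ | (∃ n : ℤ, γ 0 0 = (n : ℝ)) ∧ (∃ n : ℤ, γ 0 1 = (n : ℝ) / ℓ) ∧
       (∃ n : ℤ, γ 1 0 = (n : ℝ) * N / ℓ) ∧ (∃ n : ℤ, γ 1 1 = (n : ℝ))}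

/-- The conjugated lattice R(ℓ;g) = g⁻¹ · R(ℓ) · g. -/
def Rconj (N ℓ : ℕ) (g : M2) : Set M2 := {γ | g * γ * g⁻¹ ∈ Rlat N ℓ}

/-- P(γ): half the sum of the squares of the four entries of γ. -/
def Pfun (γ : M2) : ℝ := ((γ 0 0) ^ 2 + (γ 0 1) ^ 2 + (γ 1 0) ^ 2 + (γ 1 1) ^ 2) / 2

/-- Ω(δ,L) = {γ : P(γ) ≤ L² and P(γ) − det γ ≤ 2δL²}. -/
def OmegaSet (δ L : ℝ) : Set M2 := {γ | Pfun γ ≤ L ^ 2 ∧ Pfun γ - γ.det ≤ 2 * δ * L ^ 2}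

/-- Ω⋆(δ,L): nonzero elements of Ω(δ,L). -/
def OmegaStar (δ L : ℝ) : Set M2 := {γ | γ ∈ OmegaSet δ L ∧ γ ≠ 0}

/-- Ψ(δ,L) = {γ : P(γ) ≤ L² and P(γ) + det γ ≤ 2δL²}. -/
def PsiSet (δ L : ℝ) : Set M2 := {γ | Pfun γ ≤ L ^ 2 ∧ Pfun γ + γ.det ≤ 2 * δ * L ^ 2}

/-- Ψ⋆(δ,L): nonzero elements of Ψ(δ,L). -/
def PsiStar (δ L : ℝ) : Set M2 := {γ | γ ∈ PsiSet δ L ∧ γ ≠ 0}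

/-- Möbius action of a 2×2 real matrix on a complex number. -/
def moebius (m : M2) (z : ℂ) : ℂ :=
  ((m 0 0 : ℂ) * z + (m 0 1 : ℂ)) / ((m 1 0 : ℂ) * z + (m 1 1 : ℂ))

/-- A₀(N): determinant-one matrices of the form Q^{−1/2}·(Qa, b; Nc, Qd)
    with Q a positive divisor of N and a,b,c,d ∈ ℤ. -/
def AtkinLehner (N : ℕ) : Set M2 :=
  {σ | σ.det = 1 ∧ ∃ (Q : ℕ) (a b c d : ℤ), 0 < Q ∧ Q ∣ N ∧
     σ = (Real.sqrt Q)⁻¹ • !![(Q : ℝ) * a, (b : ℝ); (N : ℝ) * c, (Q : ℝ) * d]}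

/-- H(g) = sup_{σ ∈ A₀(N)} Im(σ·(g·i)). -/
def Hgt (N : ℕ) (g : M2) : ℝ :=
  sSup ((fun σ => (moebius σ (moebius g Complex.I)).im) '' AtkinLehner N)

/-- Spacing lemma: a finite set with real labels separated by `h` and of diameter `R`. -/
lemma spacing_card {α : Type*} (F : Finset α) (ρ : α → ℝ) (h R : ℝ) (hh : 0 < h) (hR : 0 ≤ R)
    (h1 : ∀ v ∈ F, ∀ v' ∈ F, v ≠ v' → h ≤ |ρ v - ρ v'|)
    (h2 : ∀ v ∈ F, ∀ v' ∈ F, |ρ v - ρ v'| ≤ R) : (F.card : ℝ) ≤ R / h + 2 := by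
  classical
  rcases F.eq_empty_or_nonempty with rfl | hne
  · simp; positivity
  obtain ⟨v0, hv0, hmin⟩ := F.exists_min_image ρ hne
  have hinj : Set.InjOn (fun v => ⌊(ρ v - ρ v0) / h⌋₊) (F : Set α) := by
    intro v hv v' hv' he
    by_contra hvv
    have := h1 v hv v' hv' hvv
    have a1 : 0 ≤ (ρ v - ρ v0) / h := div_nonneg (by linarith [hmin v hv]) hh.le
    have a2 : 0 ≤ (ρ v' - ρ v0) / h := div_nonneg (by linarith [hmin v' hv']) hh.le
    have b1 := Nat.floor_le a1
    have b2 := Nat.floor_le a2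
    have c1 := Nat.lt_floor_add_one ((ρ v - ρ v0) / h)
    have c2 := Nat.lt_floor_add_one ((ρ v' - ρ v0) / h)
    simp only at he
    rw [he] at b1 c1
    rw [le_div_iff₀ hh] at b1 b2
    rw [div_lt_iff₀ hh] at c1 c2
    have : |ρ v - ρ v'| < h := by
      rw [abs_lt]; constructor <;> nlinarith
    linarith
  have hsub : F.image (fun v => ⌊(ρ v - ρ v0) / h⌋₊) ⊆ Finset.range (⌊R / h⌋₊ + 1) := by
    intro n hn
    obtain ⟨v, hv, rfl⟩ := Finset.mem_image.1 hn
    rw [Finset.mem_range, Nat.lt_succ_iff]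
    apply Nat.floor_le_floor
    gcongr
    exact (le_abs_self _).trans (h2 v hv v0 hv0)
  have hc := Finset.card_le_card hsub
  rw [Finset.card_image_of_injOn hinj, Finset.card_range] at hc
  have : (F.card : ℝ) ≤ (⌊R / h⌋₊ : ℝ) + 1 := by exact_mod_cast hc
  have := Nat.floor_le (show 0 ≤ R / h by positivity)
  linarith

abbrev Z3 := Fin 3 → ℤ
abbrev R3 := Fin 3 → ℝ

lemma line_card (T : Z3 →+ R3) (e : Z3) (he : e ≠ 0) (F : Finset Z3) (h R : ℝ) (hh : 0 < h)
    (hR : 0 ≤ R)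
    (hp : ∀ v ∈ F, ∀ v' ∈ F, crossProduct e (v - v') = 0)
    (h1 : ∀ v ∈ F, ∀ v' ∈ F, v ≠ v' → h ≤ ‖T (v - v')‖)
    (h2 : ∀ v ∈ F, ∀ v' ∈ F, ‖T (v - v')‖ ≤ R) : (F.card : ℝ) ≤ R / h + 2 := by
  obtain ⟨i, hi⟩ : ∃ i, e i ≠ 0 := by
    by_contra hcon
    push Not at hcon
    exact he (funext hcon)
  have hpos : (0 : ℝ) < |(e i : ℝ)| := by
    rw [abs_pos]; exact_mod_cast hi
  have key : ∀ v ∈ F, ∀ v' ∈ F,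
      |(v i : ℝ) / e i * ‖T e‖ - (v' i : ℝ) / e i * ‖T e‖| = ‖T (v - v')‖ := by
    intro v hv v' hv'
    have hc := hp v hv v' hv'
    have h3 : (e i) • (v - v') = ((v - v') i) • e := by
      rw [cross_apply] at hc
      have c0 := congrFun hc 0
      have c1 := congrFun hc 1
      have c2 := congrFun hc 2
      simp at c0 c1 c2
      funext j
      fin_cases i <;> fin_cases j <;> simp <;> linarith
    have h4 : ((e i : ℤ) : ℝ) • T (v - v') = (((v - v') i : ℤ) : ℝ) • T e := by
      rw [Int.cast_smul_eq_zsmul, Int.cast_smul_eq_zsmul, ← map_zsmul, ← map_zsmul, h3]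
    have h5 := congrArg norm h4
    rw [norm_smul, norm_smul, Real.norm_eq_abs, Real.norm_eq_abs] at h5
    have h6 : (v i : ℝ) / e i * ‖T e‖ - (v' i : ℝ) / e i * ‖T e‖
        = (((v - v') i : ℤ) : ℝ) / e i * ‖T e‖ := by
      simp; ring
    rw [h6, abs_mul, abs_div, abs_of_nonneg (norm_nonneg _), div_mul_eq_mul_div, ← h5]
    field_simp
  apply spacing_card F (fun v => (v i : ℝ) / e i * ‖T e‖) h R hh hR
  · intro v hv v' hv' hne
    rw [key v hv v' hv']; exact h1 v hv v' hv' hne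
  · intro v hv v' hv'
    rw [key v hv v' hv']; exact h2 v hv v' hv'

lemma norm_cross_le (a b : R3) : ‖crossProduct a b‖ ≤ 2 * ‖a‖ * ‖b‖ := by
  have h : ∀ i j, |a i * b j| ≤ ‖a‖ * ‖b‖ := by
    intro i j
    rw [abs_mul]
    have := norm_le_pi_norm a i
    have := norm_le_pi_norm b j
    simp only [Real.norm_eq_abs] at *
    gcongr
  have h' : ∀ i j k l, |a i * b j - a k * b l| ≤ 2 * ‖a‖ * ‖b‖ := by
    intro i j k l
    have := abs_sub (a i * b j) (a k * b l)
    linarith [h i j, h k l]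
  rw [pi_norm_le_iff_of_nonneg (by positivity)]
  intro i
  rw [cross_apply, Real.norm_eq_abs]
  fin_cases i <;> simp <;> apply h'

lemma card_le_real {α β : Type*} [DecidableEq β] (s : Finset α) (f : α → β) (K : ℝ)
    (h : ∀ b ∈ s.image f, ((s.filter (fun x => f x = b)).card : ℝ) ≤ K) :
    (s.card : ℝ) ≤ K * (s.image f).card := by
  rw [Finset.card_eq_sum_card_image f s, Nat.cast_sum, mul_comm, ← nsmul_eq_mul]
  exact Finset.sum_le_card_nsmul _ _ _ h

lemma lattice_count (T U : Z3 →+ R3) (D lam mu : ℝ) (hD : 0 < D) (hlam : 0 < lam) (hmu : 0 < mu)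
    (hTU : ∀ a b, crossProduct (T a) (T b) = U (crossProduct a b))
    (hUT : ∀ a b, crossProduct (U a) (U b) = D • T (crossProduct a b))
    (hl : ∀ v, v ≠ 0 → lam ≤ ‖T v‖) (hm : ∀ v, v ≠ 0 → mu ≤ ‖U v‖)
    (S : Finset Z3) (hS : ∀ v, v ∈ S ↔ ‖T v‖ ≤ 1) :
    (S.card : ℝ) ≤ 1 + 4 / lam + 96 / mu + 384 / D := by
  classical
  by_cases hz : ∀ v ∈ S, v = 0
  · have : S ⊆ {0} := fun v hv => by simp [hz v hv]
    have := Finset.card_le_card this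
    have h1 : (S.card : ℝ) ≤ 1 := by exact_mod_cast this
    have : 0 ≤ 4 / lam + 96 / mu + 384 / D := by positivity
    linarith
  push Not at hz
  obtain ⟨v2, hv2, hv20⟩ := hz
  obtain ⟨v1, hv1, hmin⟩ := (S.filter (· ≠ 0)).exists_min_image (fun v => ‖T v‖)
    ⟨v2, by simp [hv2, hv20]⟩
  simp only [Finset.mem_filter] at hv1 hmin
  obtain ⟨hv1S, hv10⟩ := hv1
  set l1 := ‖T v1‖ with hl1
  have hl1le : l1 ≤ 1 := (hS v1).1 hv1S
  have hl1pos : 0 < l1 := hlam.trans_le (hl v1 hv10)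
  have hmin' : ∀ v, v ≠ 0 → l1 ≤ ‖T v‖ := by
    intro v hv
    by_cases hvS : v ∈ S
    · exact hmin v ⟨hvS, hv⟩
    · rw [hS] at hvS; linarith
  set φ : Z3 → Z3 := fun v => crossProduct v1 v with hφ
  have hfib : ∀ b ∈ S.image φ, ((S.filter (fun x => φ x = b)).card : ℝ) ≤ 4 / l1 := by
    intro b _
    have := line_card T v1 hv10 (S.filter (fun x => φ x = b)) l1 2 hl1pos (by norm_num) ?_ ?_ ?_
    · have h2 : 2 ≤ 2 / l1 := by rw [le_div_iff₀ hl1pos]; linarith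
      have h3 : 4 / l1 = 2 / l1 + 2 / l1 := by ring
      linarith
    · intro v hv v' hv'
      rw [map_sub, sub_eq_zero]
      exact (Finset.mem_filter.1 hv).2.trans (Finset.mem_filter.1 hv').2.symm
    · intro v _ v' _ hne
      exact hmin' _ (sub_ne_zero.2 hne)
    · intro v hv v' hv'
      rw [map_sub]
      have := (hS v).1 (Finset.mem_filter.1 hv).1
      have := (hS v').1 (Finset.mem_filter.1 hv').1
      linarith [norm_sub_le (T v) (T v')]
  have hc1 := card_le_real S φ _ hfib
  set W := S.image φ with hW
  have hWn : ∀ w ∈ W, ∃ v ∈ S, w = crossProduct v1 v ∧ ‖U w‖ ≤ 2 * l1 := by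
    intro w hw
    obtain ⟨v, hv, rfl⟩ := Finset.mem_image.1 hw
    refine ⟨v, hv, rfl, ?_⟩
    rw [hφ]; dsimp only
    rw [← hTU]
    have := norm_cross_le (T v1) (T v)
    have h1 := (hS v).1 hv
    nlinarith
  have h4l : 4 / l1 ≤ 4 / lam := by
    have := hl v1 hv10
    gcongr
  have h96 : 0 ≤ 96 / mu + 384 / D := by positivity
  by_cases hsub : ∀ w ∈ W, ∀ w' ∈ W, w = w'
  · have : (W.card : ℝ) ≤ 1 := by
      exact_mod_cast Finset.card_le_one.2 hsub
    have : 4 / l1 * W.card ≤ 4 / l1 * 1 := by gcongr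
    linarith
  push Not at hsub
  obtain ⟨wa, hwa, wb, hwb, hab⟩ := hsub
  set E := (W ×ˢ W).filter (fun p => p.1 ≠ p.2) with hE
  obtain ⟨⟨p, q⟩, hpq, hmin2⟩ := E.exists_min_image (fun p => ‖U (p.1 - p.2)‖)
    ⟨(wa, wb), by simp [hE, hwa, hwb, hab]⟩
  simp only [hE, Finset.mem_filter, Finset.mem_product] at hpq hmin2
  obtain ⟨⟨hp, hq⟩, hpqne⟩ := hpq
  set u1 := p - q with hu1
  have hu10 : u1 ≠ 0 := sub_ne_zero.2 hpqne
  set m1 := ‖U u1‖ with hm1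
  have hm1mu : mu ≤ m1 := hm u1 hu10
  have hm1pos : 0 < m1 := hmu.trans_le hm1mu
  have hWW : ∀ w ∈ W, ∀ w' ∈ W, ‖U (w - w')‖ ≤ 4 * l1 := by
    intro w hw w' hw'
    obtain ⟨_, _, _, h1⟩ := hWn w hw
    obtain ⟨_, _, _, h2⟩ := hWn w' hw'
    rw [map_sub]
    linarith [norm_sub_le (U w) (U w')]
  have hm1l : m1 ≤ 4 * l1 := hWW p hp q hq
  set ψ : Z3 → Z3 := fun w => crossProduct u1 w with hψ
  have hfib2 : ∀ b ∈ W.image ψ, ((W.filter (fun x => ψ x = b)).card : ℝ) ≤ 12 * l1 / m1 := by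
    intro b _
    have := line_card U u1 hu10 (W.filter (fun x => ψ x = b)) m1 (4 * l1) hm1pos (by positivity)
      ?_ ?_ ?_
    · have h2 : 2 ≤ 8 * l1 / m1 := by rw [le_div_iff₀ hm1pos]; linarith
      have h3 : 12 * l1 / m1 = 4 * l1 / m1 + 8 * l1 / m1 := by ring
      linarith
    · intro v hv v' hv'
      rw [map_sub, sub_eq_zero]
      exact (Finset.mem_filter.1 hv).2.trans (Finset.mem_filter.1 hv').2.symm
    · intro v hv v' hv' hne
      exact hmin2 (v, v') ⟨⟨(Finset.mem_filter.1 hv).1, (Finset.mem_filter.1 hv').1⟩, hne⟩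
    · intro v hv v' hv'
      exact hWW _ (Finset.mem_filter.1 hv).1 _ (Finset.mem_filter.1 hv').1
  have hc2 := card_le_real W ψ _ hfib2
  have hc3 : ((W.image ψ).card : ℝ) ≤ 8 * m1 / D + 2 := by
    have := line_card T v1 hv10 (W.image ψ) l1 (8 * m1 * l1 / D) hl1pos (by positivity)
      ?_ ?_ ?_
    · have h3 : 8 * m1 * l1 / D / l1 = 8 * m1 / D := by field_simp
      rwa [h3] at this
    · intro v hv v' hv'
      obtain ⟨w, hw, rfl⟩ := Finset.mem_image.1 hv
      obtain ⟨w', hw', rfl⟩ := Finset.mem_image.1 hv'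
      obtain ⟨y, _, rfl, _⟩ := hWn w hw
      obtain ⟨y', _, rfl, _⟩ := hWn w' hw'
      obtain ⟨yp, _, hyp, _⟩ := hWn p hp
      obtain ⟨yq, _, hyq, _⟩ := hWn q hq
      rw [hψ]; dsimp only
      rw [← map_sub, ← map_sub, hu1, hyp, hyq, ← map_sub]
      generalize yp - yq = A
      generalize y - y' = B
      simp only [cross_apply]
      funext j
      fin_cases j <;> simp <;> ring
    · intro v _ v' _ hne
      exact hmin' _ (sub_ne_zero.2 hne)
    · intro v hv v' hv'
      obtain ⟨w, hw, rfl⟩ := Finset.mem_image.1 hv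
      obtain ⟨w', hw', rfl⟩ := Finset.mem_image.1 hv'
      rw [hψ]; dsimp only
      rw [← map_sub]
      have h1 := hUT u1 (w - w')
      have h2 := norm_cross_le (U u1) (U (w - w'))
      rw [h1, norm_smul, Real.norm_eq_abs, abs_of_pos hD] at h2
      rw [le_div_iff₀ hD]
      have := hWW w hw w' hw'
      have : 2 * ‖U u1‖ * ‖U (w - w')‖ ≤ 2 * m1 * (4 * l1) := by gcongr
      linarith
  calc (S.card : ℝ) ≤ 4 / l1 * (12 * l1 / m1 * (8 * m1 / D + 2)) := by
        refine hc1.trans ?_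
        gcongr
        refine hc2.trans ?_
        gcongr
    _ = 96 / m1 + 384 / D := by field_simp; ring
    _ ≤ 96 / mu + 384 / D := by gcongr
    _ ≤ _ := by
        have : 0 ≤ 4 / lam := by positivity
        linarith

lemma moebius_im (s g : M2) (hs : s.det = 1) (hg : g.det = 1) :
    (moebius s (moebius g Complex.I)).im =
      1 / ((s 1 0 * g 0 0 + s 1 1 * g 1 0) ^ 2 + (s 1 0 * g 0 1 + s 1 1 * g 1 1) ^ 2) := by
  rw [Matrix.det_fin_two] at hs hg
  set p := g 0 0
  set q := g 0 1
  set r := g 1 0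
  set w := g 1 1
  set a := s 0 0
  set b := s 0 1
  set c := s 1 0
  set d := s 1 1
  have hj : (r : ℂ) * Complex.I + w ≠ 0 := by
    intro h
    have h1 := congrArg Complex.re h
    have h2 := congrArg Complex.im h
    simp at h1 h2
    rw [h1, h2] at hg
    norm_num at hg
  have e1 : moebius s (moebius g Complex.I) =
      (((a * p + b * r : ℝ) : ℂ) * Complex.I + ((a * q + b * w : ℝ) : ℂ)) /
      (((c * p + d * r : ℝ) : ℂ) * Complex.I + ((c * q + d * w : ℝ) : ℂ)) := by
    change ((a : ℂ) * (((p : ℂ) * Complex.I + q) / ((r : ℂ) * Complex.I + w)) + b) /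
      ((c : ℂ) * (((p : ℂ) * Complex.I + q) / ((r : ℂ) * Complex.I + w)) + d) = _
    have n1 : (a : ℂ) * (((p : ℂ) * Complex.I + q) / ((r : ℂ) * Complex.I + w)) + b
      = (((a * p + b * r : ℝ) : ℂ) * Complex.I + ((a * q + b * w : ℝ) : ℂ))
        / ((r : ℂ) * Complex.I + w) := by
      rw [mul_div_assoc', div_add' _ _ _ hj]
      congr 1
      push_cast; ring
    have n2 : (c : ℂ) * (((p : ℂ) * Complex.I + q) / ((r : ℂ) * Complex.I + w)) + d
      = (((c * p + d * r : ℝ) : ℂ) * Complex.I + ((c * q + d * w : ℝ) : ℂ))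
        / ((r : ℂ) * Complex.I + w) := by
      rw [mul_div_assoc', div_add' _ _ _ hj]
      congr 1
      push_cast; ring
    rw [n1, n2, div_div_div_cancel_right₀ hj]
  rw [e1, Complex.div_im]
  have hdet : (a * p + b * r) * (c * q + d * w) - (a * q + b * w) * (c * p + d * r) = 1 := by
    linear_combination (a * d - b * c) * hg + hs
  simp only [Complex.normSq_apply, Complex.add_im, Complex.add_re, Complex.mul_im, Complex.mul_re,
    Complex.ofReal_re, Complex.ofReal_im, Complex.I_re, Complex.I_im]
  rw [← sub_div]
  congr 1
  · linear_combination hdet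
  · ring

lemma AL_bottom (N : ℕ) (hN : 0 < N) (s : M2) (hs : s ∈ AtkinLehner N) :
    1 ≤ s 1 0 ^ 2 + s 1 1 ^ 2 := by
  obtain ⟨hdet, Q, a, b, c, d, hQ, hQN, rfl⟩ := hs
  have hQr : (0 : ℝ) < Q := by exact_mod_cast hQ
  have hQ1 : (1 : ℝ) ≤ Q := by exact_mod_cast hQ
  have hNQ : (Q : ℝ) ≤ N := by exact_mod_cast Nat.le_of_dvd hN hQN
  have hsq : ((Real.sqrt Q)⁻¹) ^ 2 = (Q : ℝ)⁻¹ := by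
    rw [inv_pow, Real.sq_sqrt hQr.le]
  have hcd : 1 ≤ (c : ℝ) ^ 2 + (d : ℝ) ^ 2 := by
    have : 1 ≤ c ^ 2 + d ^ 2 := by
      by_contra hcon
      have hc : c = 0 := by nlinarith [sq_nonneg c, sq_nonneg d]
      have hd : d = 0 := by nlinarith [sq_nonneg c, sq_nonneg d]
      subst hc; subst hd
      simp [Matrix.det_fin_two] at hdet
    exact_mod_cast this
  simp only [Matrix.smul_apply, Matrix.of_apply, Matrix.cons_val', Matrix.cons_val_zero,
    Matrix.cons_val_one, smul_eq_mul, mul_pow, hsq, Matrix.cons_val_fin_one]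
  rw [← mul_add, inv_mul_eq_div, le_div_iff₀ hQr]
  have : (Q : ℝ) ^ 2 * c ^ 2 ≤ N ^ 2 * c ^ 2 := by gcongr
  nlinarith

lemma Hgt_bdd (N : ℕ) (hN : 0 < N) (g : M2) (hg : g.det = 1) :
    BddAbove ((fun σ => (moebius σ (moebius g Complex.I)).im) '' AtkinLehner N) := by
  refine ⟨g 0 0 ^ 2 + g 0 1 ^ 2 + g 1 0 ^ 2 + g 1 1 ^ 2, ?_⟩
  rintro _ ⟨s, hs, rfl⟩
  have h1 := AL_bottom N hN s hs
  dsimp only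
  rw [moebius_im s g hs.1 hg]
  rw [Matrix.det_fin_two] at hg
  set p := g 0 0
  set q := g 0 1
  set r := g 1 0
  set w := g 1 1
  set c := s 1 0
  set d := s 1 1
  set X := c * p + d * r with hX
  set Y := c * q + d * w with hY
  have e1 : c = w * X - r * Y := by rw [hX, hY]; linear_combination -c * hg
  have e2 : d = p * Y - q * X := by rw [hX, hY]; linear_combination -d * hg
  have h2 : 1 ≤ (p ^ 2 + q ^ 2 + r ^ 2 + w ^ 2) * (X ^ 2 + Y ^ 2) := by
    have : c ^ 2 + d ^ 2 ≤ (p ^ 2 + q ^ 2 + r ^ 2 + w ^ 2) * (X ^ 2 + Y ^ 2) := by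
      have i1 : c ^ 2 ≤ (w ^ 2 + r ^ 2) * (X ^ 2 + Y ^ 2) := by
        rw [e1]; nlinarith [sq_nonneg (w * Y + r * X)]
      have i2 : d ^ 2 ≤ (p ^ 2 + q ^ 2) * (X ^ 2 + Y ^ 2) := by
        rw [e2]; nlinarith [sq_nonneg (p * X + q * Y)]
      linarith
    linarith
  have h3 : 0 < X ^ 2 + Y ^ 2 := by
    by_contra hcon
    have : X ^ 2 + Y ^ 2 = 0 := le_antisymm (not_lt.1 hcon) (by positivity)
    rw [this] at h2; linarith
  rw [div_le_iff₀ h3]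
  exact h2

lemma Hgt_lower (N : ℕ) (hN : 0 < N) (g : M2) (hg : g.det = 1) (s : M2) (hs : s ∈ AtkinLehner N) :
    1 ≤ Hgt N g *
      ((s 1 0 * g 0 0 + s 1 1 * g 1 0) ^ 2 + (s 1 0 * g 0 1 + s 1 1 * g 1 1) ^ 2) := by
  have h1 : (moebius s (moebius g Complex.I)).im ≤ Hgt N g :=
    le_csSup (Hgt_bdd N hN g hg) ⟨s, hs, rfl⟩
  rw [moebius_im s g hs.1 hg] at h1
  have hb := AL_bottom N hN s hs
  rw [Matrix.det_fin_two] at hg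
  set X := s 1 0 * g 0 0 + s 1 1 * g 1 0 with hX
  set Y := s 1 0 * g 0 1 + s 1 1 * g 1 1 with hY
  have h3 : 0 < X ^ 2 + Y ^ 2 := by
    by_contra hcon
    have h0 : X ^ 2 + Y ^ 2 = 0 := le_antisymm (not_lt.1 hcon) (by positivity)
    have x0 : X = 0 := by nlinarith [sq_nonneg X, sq_nonneg Y]
    have y0 : Y = 0 := by nlinarith [sq_nonneg X, sq_nonneg Y]
    have e1 : s 1 0 = g 1 1 * X - g 1 0 * Y := by rw [hX, hY]; linear_combination -(s 1 0) * hg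
    have e2 : s 1 1 = g 0 0 * Y - g 0 1 * X := by rw [hX, hY]; linear_combination -(s 1 1) * hg
    rw [x0, y0] at e1 e2
    rw [e1, e2] at hb
    norm_num at hb
  rwa [div_le_iff₀ h3] at h1

/-- Degenerate integral binary forms are multiples of squares. -/
lemma degenerate_form (A B C : ℤ) (h0 : ¬ (A = 0 ∧ B = 0 ∧ C = 0)) (hdisc : B ^ 2 = A * C) :
    ∃ k r s : ℤ, k ≠ 0 ∧ IsCoprime r s ∧ A = k * r ^ 2 ∧ B = k * r * s ∧ C = k * s ^ 2 := by
  by_cases hA : A = 0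
  · subst hA
    have hB : B = 0 := by simpa using hdisc
    subst hB
    refine ⟨C, 0, 1, by tauto, isCoprime_one_right, by ring, by ring, by ring⟩
  have hgpos : 0 < Int.gcd A B := Int.gcd_pos_of_ne_zero_left _ hA
  obtain ⟨r, s, hrs, hr, hs⟩ : ∃ r s : ℤ, IsCoprime r s ∧ A = r * Int.gcd A B ∧
      B = s * Int.gcd A B := by
    obtain ⟨r, s, h1, h2, h3⟩ := Int.exists_gcd_one hgpos
    exact ⟨r, s, Int.isCoprime_iff_gcd_eq_one.2 h1, h2, h3⟩
  set G : ℤ := (Int.gcd A B : ℤ)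
  have hG : G ≠ 0 := by positivity
  have hr0 : r ≠ 0 := by rintro rfl; simp at hr; exact hA hr
  have h1 : s ^ 2 * G = r * C := by
    have : G * (s ^ 2 * G) = G * (r * C) := by
      rw [hr, hs] at hdisc; linear_combination hdisc
    exact mul_left_cancel₀ hG this
  have h2 : r ∣ G := by
    have h3 : r ∣ s ^ 2 * G := ⟨C, h1⟩
    exact (hrs.pow_right).dvd_of_dvd_mul_left h3
  obtain ⟨k, hk⟩ := h2
  refine ⟨k, r, s, ?_, hrs, ?_, ?_, ?_⟩
  · rintro rfl; simp at hk; exact hG hk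
  · rw [hr, hk]; ring
  · rw [hs, hk]; ring
  · rw [hk] at h1
    have : r * C = r * (k * s ^ 2) := by linear_combination -h1
    exact mul_left_cancel₀ hr0 this

lemma height_form (N : ℕ) (hN : 0 < N) (hsf : Squarefree N) (g : M2) (hg : g.det = 1)
    (A B C : ℤ) (h0 : ¬ (A = 0 ∧ B = 0 ∧ C = 0)) (hdisc : B ^ 2 = A * C) (hNA : (N : ℤ) ∣ A) :
    1 ≤ Hgt N g * |(A : ℝ) * (g 0 0 ^ 2 + g 0 1 ^ 2) + 2 * B * (g 0 0 * g 1 0 + g 0 1 * g 1 1)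
      + C * (g 1 0 ^ 2 + g 1 1 ^ 2)| := by
  obtain ⟨k, r, s, hk, hrs, hA, hB, hC⟩ := degenerate_form A B C h0 hdisc
  -- split N = e * Q with e = gcd (r, N)
  obtain ⟨e, Q, r', hNe, hr, hcop, hQk⟩ : ∃ e Q : ℕ, ∃ r' : ℤ, N = e * Q ∧ r = e * r' ∧
      IsCoprime (Q : ℤ) r ∧ (Q : ℤ) ∣ k := by
    obtain ⟨Q, hQ⟩ : Nat.gcd r.natAbs N ∣ N := Nat.gcd_dvd_right _ _
    obtain ⟨r', hr'⟩ : ((Nat.gcd r.natAbs N : ℕ) : ℤ) ∣ r :=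
      Int.natCast_dvd.2 (Nat.gcd_dvd_left _ _)
    have hcop : Nat.Coprime Q r.natAbs := by
      rw [Nat.coprime_iff_gcd_eq_one]
      by_contra hne
      obtain ⟨p, hp, hpd⟩ := Nat.exists_prime_and_dvd hne
      have hp1 : p ∣ Q := hpd.trans (Nat.gcd_dvd_left _ _)
      have hp2 : p ∣ r.natAbs := hpd.trans (Nat.gcd_dvd_right _ _)
      have hp3 : p ∣ N := hp1.trans ⟨_, by rw [mul_comm]; exact hQ⟩
      have hp4 : p ∣ Nat.gcd r.natAbs N := Nat.dvd_gcd hp2 hp3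
      have hp5 : p * p ∣ N := by
        conv_rhs => rw [hQ]
        exact mul_dvd_mul hp4 hp1
      exact hp.one_lt.ne' (Nat.isUnit_iff.1 (hsf p hp5))
    have hcop' : IsCoprime (Q : ℤ) r := by
      rw [Int.isCoprime_iff_gcd_eq_one]; simpa [Int.gcd] using hcop
    refine ⟨Nat.gcd r.natAbs N, Q, r', hQ, hr', hcop', ?_⟩
    have h1 : (Q : ℤ) ∣ k * r ^ 2 := by
      rw [← hA]
      refine dvd_trans ?_ hNA
      have hQN : Q ∣ N := Dvd.intro_left _ hQ.symm
      exact_mod_cast hQN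
    exact (hcop'.pow_right).dvd_of_dvd_mul_right h1
  have hQpos : 0 < Q := by
    rcases Nat.eq_zero_or_pos Q with h | h
    · subst h; simp at hNe; omega
    · exact h
  obtain ⟨k', hk'⟩ := hQk
  obtain ⟨b0, a0, hab⟩ : IsCoprime r (Q * s) := IsCoprime.mul_right hcop.symm hrs
  have hQr : (0 : ℝ) < Q := by exact_mod_cast hQpos
  have hsq : (Real.sqrt Q)⁻¹ ^ 2 = (Q : ℝ)⁻¹ := by
    rw [inv_pow, Real.sq_sqrt hQr.le]
  set σ : M2 := (Real.sqrt Q)⁻¹ • !![(Q : ℝ) * (a0 : ℤ), ((-b0 : ℤ) : ℝ); (N : ℝ) * (r' : ℤ),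
    (Q : ℝ) * (s : ℤ)] with hσ
  have habR : (b0 : ℝ) * r + a0 * (Q * s) = 1 := by exact_mod_cast hab
  have hrR : (r : ℝ) = e * r' := by exact_mod_cast hr
  have hNR : (N : ℝ) = e * Q := by exact_mod_cast hNe
  have hmem : σ ∈ AtkinLehner N := by
    refine ⟨?_, Q, a0, -b0, r', s, hQpos, ⟨e, by rw [hNe, mul_comm]⟩, hσ⟩
    rw [hσ, Matrix.det_smul, Matrix.det_fin_two]
    simp only [Fintype.card_fin, hsq, Matrix.of_apply, Matrix.cons_val', Matrix.cons_val_zero,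
      Matrix.cons_val_one, Matrix.cons_val_fin_one]
    rw [hNR]
    field_simp
    rw [hrR] at habR
    push_cast
    linear_combination habR
  have hl := Hgt_lower N hN g hg σ hmem
  have hHpos : 0 < Hgt N g := by
    by_contra hcon
    have : 0 ≤ (σ 1 0 * g 0 0 + σ 1 1 * g 1 0) ^ 2 + (σ 1 0 * g 0 1 + σ 1 1 * g 1 1) ^ 2 := by
      positivity
    nlinarith
  refine hl.trans ?_
  apply mul_le_mul_of_nonneg_left _ hHpos.le
  have s10 : σ 1 0 = (Real.sqrt Q)⁻¹ * (N * r') := by simp [hσ]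
  have s11 : σ 1 1 = (Real.sqrt Q)⁻¹ * (Q * s) := by simp [hσ]
  have ebot : (σ 1 0 * g 0 0 + σ 1 1 * g 1 0) ^ 2 + (σ 1 0 * g 0 1 + σ 1 1 * g 1 1) ^ 2 =
      Q * ((r * g 0 0 + s * g 1 0) ^ 2 + (r * g 0 1 + s * g 1 1) ^ 2) := by
    rw [s10, s11]
    have : ∀ x y : ℝ, ((Real.sqrt Q)⁻¹ * (N * r') * x + (Real.sqrt Q)⁻¹ * (Q * s) * y) ^ 2 =
        Q * (r * x + s * y) ^ 2 := by
      intro x y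
      have : ((Real.sqrt Q)⁻¹ * (N * r') * x + (Real.sqrt Q)⁻¹ * (Q * s) * y) ^ 2 =
        (Real.sqrt Q)⁻¹ ^ 2 * (Q * (r * x + s * y)) ^ 2 := by
        rw [hNR, hrR]; ring
      rw [this, hsq]; field_simp
    rw [this, this]; ring
  rw [ebot]
  have eform : (A : ℝ) * (g 0 0 ^ 2 + g 0 1 ^ 2) + 2 * B * (g 0 0 * g 1 0 + g 0 1 * g 1 1)
      + C * (g 1 0 ^ 2 + g 1 1 ^ 2) =
      k' * (Q * ((r * g 0 0 + s * g 1 0) ^ 2 + (r * g 0 1 + s * g 1 1) ^ 2)) := by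
    rw [hA, hB, hC, hk']; push_cast; ring
  rw [eform, abs_mul]
  have hk1 : 1 ≤ |(k' : ℝ)| := by
    have : k' ≠ 0 := by rintro rfl; simp at hk'; exact hk hk'
    exact_mod_cast Int.one_le_abs this
  have hnn : 0 ≤ Q * ((r * g 0 0 + s * g 1 0) ^ 2 + (r * g 0 1 + s * g 1 1) ^ 2) := by positivity
  rw [abs_of_nonneg hnn]
  nlinarith

/-- The additive map ℤ³ → ℝ³ attached to a 3×3 real matrix. -/
def mapT (A : Fin 3 → Fin 3 → ℝ) : Z3 →+ R3 :=
  AddMonoidHom.mk' (fun v i => A i 0 * v 0 + A i 1 * v 1 + A i 2 * v 2) (by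
    intro a b; funext i; simp; ring)

lemma mapT_apply (A : Fin 3 → Fin 3 → ℝ) (v : Z3) (i : Fin 3) :
    mapT A v i = A i 0 * v 0 + A i 1 * v 1 + A i 2 * v 2 := rfl

/-- Cofactor matrix, by cross products of rows. -/
def cofT (A : Fin 3 → Fin 3 → ℝ) : Fin 3 → Fin 3 → ℝ :=
  ![crossProduct (A 1) (A 2), crossProduct (A 2) (A 0), crossProduct (A 0) (A 1)]

def detT (A : Fin 3 → Fin 3 → ℝ) : ℝ :=
  A 0 0 * (A 1 1 * A 2 2 - A 1 2 * A 2 1) + A 0 1 * (A 1 2 * A 2 0 - A 1 0 * A 2 2)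
    + A 0 2 * (A 1 0 * A 2 1 - A 1 1 * A 2 0)

lemma mapT_cross (A : Fin 3 → Fin 3 → ℝ) (a b : Z3) :
    crossProduct (mapT A a) (mapT A b) = mapT (cofT A) (crossProduct a b) := by
  funext i
  rw [mapT_apply]
  simp only [cross_apply, cofT, mapT_apply]
  fin_cases i <;> simp <;> ring

lemma mapT_cof_cross (A : Fin 3 → Fin 3 → ℝ) (a b : Z3) :
    crossProduct (mapT (cofT A) a) (mapT (cofT A) b) = detT A • mapT A (crossProduct a b) := by
  funext i
  rw [Pi.smul_apply, mapT_apply]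
  simp only [cross_apply, cofT, mapT_apply, detT]
  fin_cases i <;> simp <;> ring

lemma mapT_finite (A : Fin 3 → Fin 3 → ℝ) (hD : 0 < detT A) :
    {v : Z3 | ‖mapT A v‖ ≤ 1}.Finite := by
  set K : ℝ := ∑ i, ∑ j, |cofT A i j| with hK
  have hb : ∀ v : Z3, ‖mapT A v‖ ≤ 1 → ∀ j, |(v j : ℝ)| ≤ K / detT A := by
    intro v hv j
    have hi : ∀ i, |mapT A v i| ≤ 1 := fun i => by
      have := norm_le_pi_norm (mapT A v) i
      rw [Real.norm_eq_abs] at this; linarith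
    have e : detT A * v j = ∑ i, cofT A i j * mapT A v i := by
      rw [Fin.sum_univ_three]
      simp only [mapT_apply, detT, cofT, cross_apply]
      fin_cases j <;> simp <;> ring
    rw [le_div_iff₀ hD]
    have : |(v j : ℝ)| * detT A = |∑ i, cofT A i j * mapT A v i| := by
      rw [← e, abs_mul, abs_of_pos hD, mul_comm]
    rw [this]
    refine (Finset.abs_sum_le_sum_abs _ _).trans ?_
    rw [hK]
    apply Finset.sum_le_sum
    intro i _
    rw [abs_mul]
    have h1 : |cofT A i j| ≤ ∑ j, |cofT A i j| :=
      Finset.single_le_sum (f := fun j => |cofT A i j|) (fun _ _ => abs_nonneg _)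
        (Finset.mem_univ j)
    have := hi i
    nlinarith [abs_nonneg (cofT A i j)]
  refine (Set.Finite.pi (t := fun _ : Fin 3 => Set.Icc (-⌈K / detT A⌉) ⌈K / detT A⌉)
    (fun _ => Set.finite_Icc _ _)).subset ?_
  intro v hv
  rw [Set.mem_univ_pi]
  intro j
  have h := abs_le.1 (hb v hv j)
  have hc := Int.le_ceil (K / detT A)
  constructor
  · have : (-(⌈K / detT A⌉ : ℝ)) ≤ v j := by linarith [h.1]
    exact_mod_cast this
  · have : (v j : ℝ) ≤ ⌈K / detT A⌉ := by linarith [h.2]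
    exact_mod_cast this

/-- The matrix of the normalized coordinates (α, t, s) of g⁻¹ M g. -/
def coordA (ℓ m L d p q r w : ℝ) : Fin 3 → Fin 3 → ℝ :=
  ![![(p * w + q * r) / L, w * r / ℓ / L, -(m * p * q) / L],
    ![(w * q - p * r) / L, (w ^ 2 - r ^ 2) / (2 * ℓ) / L, m * (p ^ 2 - q ^ 2) / 2 / L],
    ![-(p * r + w * q) / (d * L), -(r ^ 2 + w ^ 2) / (2 * ℓ) / (d * L),
      m * (p ^ 2 + q ^ 2) / 2 / (d * L)]]

def alF (p q r w a b c : ℝ) : ℝ := a * (p * w + q * r) + b * (w * r) - c * (p * q)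
def tF (p q r w a b c : ℝ) : ℝ :=
  a * (w * q - p * r) + b * (w ^ 2 - r ^ 2) / 2 + c * (p ^ 2 - q ^ 2) / 2
def sF (p q r w a b c : ℝ) : ℝ :=
  -a * (p * r + w * q) - b * (r ^ 2 + w ^ 2) / 2 + c * (p ^ 2 + q ^ 2) / 2

lemma form_disc (p q r w a b c : ℝ) (h : p * w - q * r = 1) :
    alF p q r w a b c ^ 2 + tF p q r w a b c ^ 2 - sF p q r w a b c ^ 2 = a ^ 2 + b * c := by
  have : alF p q r w a b c ^ 2 + tF p q r w a b c ^ 2 - sF p q r w a b c ^ 2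
    = (a ^ 2 + b * c) * (p * w - q * r) ^ 2 := by
    unfold alF tF sF; ring
  rw [this, h]; ring

lemma coord_det (ℓ m L d p q r w : ℝ) (hl : ℓ ≠ 0) (hL : L ≠ 0) (hd : d ≠ 0)
    (h : p * w - q * r = 1) : detT (coordA ℓ m L d p q r w) = m / (2 * ℓ * d * L ^ 3) := by
  have : detT (coordA ℓ m L d p q r w) = (p * w - q * r) ^ 3 * (m / (2 * ℓ * d * L ^ 3)) := by
    simp [detT, coordA]
    field_simp
    ring
  rw [this, h]; ring

lemma coord_T (ℓ m L d p q r w : ℝ) (v : Z3) :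
    mapT (coordA ℓ m L d p q r w) v =
      ![alF p q r w (v 0) (v 1 / ℓ) (v 2 * m) / L, tF p q r w (v 0) (v 1 / ℓ) (v 2 * m) / L,
        sF p q r w (v 0) (v 1 / ℓ) (v 2 * m) / (d * L)] := by
  funext i
  rw [mapT_apply]
  fin_cases i <;> simp [coordA, alF, tF, sF] <;> ring

lemma coord_U (ℓ m L d p q r w : ℝ) (hl : ℓ ≠ 0) (hm : m ≠ 0) (hL : L ≠ 0) (hd : d ≠ 0)
    (h : p * w - q * r = 1) (v : Z3) :
    mapT (cofT (coordA ℓ m L d p q r w)) v =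
      ![m / ℓ * alF p q r w (v 0 / 2) (v 2 / m) (ℓ * v 1) / (d * L ^ 2),
        m / ℓ * tF p q r w (v 0 / 2) (v 2 / m) (ℓ * v 1) / (d * L ^ 2),
        -(m / ℓ * sF p q r w (v 0 / 2) (v 2 / m) (ℓ * v 1)) / L ^ 2] := by
  have : mapT (cofT (coordA ℓ m L d p q r w)) v = (p * w - q * r) •
      ![m / ℓ * alF p q r w (v 0 / 2) (v 2 / m) (ℓ * v 1) / (d * L ^ 2),
        m / ℓ * tF p q r w (v 0 / 2) (v 2 / m) (ℓ * v 1) / (d * L ^ 2),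
        -(m / ℓ * sF p q r w (v 0 / 2) (v 2 / m) (ℓ * v 1)) / L ^ 2] := by
    funext i
    rw [mapT_apply]
    fin_cases i <;> simp [coordA, alF, tF, sF, cofT, cross_apply] <;> field_simp <;> ring
  rw [this, h, one_smul]

lemma one_le_of_sq {x : ℝ} (hx : 0 ≤ x) (h : 1 ≤ x ^ 2) : 1 ≤ x := by
  by_contra hcon
  nlinarith

lemma abs_disc_le {a t s K : ℝ} (ha : a ^ 2 ≤ K) (ht : t ^ 2 ≤ K) (hs : s ^ 2 ≤ K) :
    |a ^ 2 + t ^ 2 - s ^ 2| ≤ 2 * K := by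
  have := sq_nonneg a
  have := sq_nonneg t
  have := sq_nonneg s
  rw [abs_le]; constructor <;> linarith

set_option maxHeartbeats 800000 in
lemma lam_bound (N ℓ m : ℕ) (hN : 0 < N) (hsf : Squarefree N) (hNm : N = ℓ * m) (hl : 0 < ℓ)
    (hm : 0 < m) (g : M2) (hg : g.det = 1) (hH : 0 < Hgt N g) (L d : ℝ) (hL : 0 < L) (hd : 0 < d)
    (hd1 : d ≤ 1) (v : Z3) (hv : v ≠ 0) :
    1 ≤ ‖mapT (coordA ℓ m L d (g 0 0) (g 0 1) (g 1 0) (g 1 1)) v‖ *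
      (2 * (Real.sqrt ℓ * L + ℓ * Hgt N g * d * L)) := by
  have hlR : (0 : ℝ) < ℓ := by exact_mod_cast hl
  have hmR : (0 : ℝ) < m := by exact_mod_cast hm
  have hNR : (N : ℝ) = ℓ * m := by exact_mod_cast hNm
  have hdisc := form_disc (g 0 0) (g 0 1) (g 1 0) (g 1 1) (v 0) (v 1 / ℓ) (v 2 * m)
    (by rw [Matrix.det_fin_two] at hg; exact hg)
  have hT := coord_T ℓ m L d (g 0 0) (g 0 1) (g 1 0) (g 1 1) v
  set ν := ‖mapT (coordA ℓ m L d (g 0 0) (g 0 1) (g 1 0) (g 1 1)) v‖ with hν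
  have hνn : 0 ≤ ν := norm_nonneg _
  have n0 := norm_le_pi_norm (mapT (coordA ℓ m L d (g 0 0) (g 0 1) (g 1 0) (g 1 1)) v) 0
  have n1 := norm_le_pi_norm (mapT (coordA ℓ m L d (g 0 0) (g 0 1) (g 1 0) (g 1 1)) v) 1
  have n2 := norm_le_pi_norm (mapT (coordA ℓ m L d (g 0 0) (g 0 1) (g 1 0) (g 1 1)) v) 2
  rw [← hν, hT] at n0 n1 n2
  have hs : 2 * (ℓ : ℝ) * sF (g 0 0) (g 0 1) (g 1 0) (g 1 1) (v 0) (v 1 / ℓ) (v 2 * m) =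
    ((N * v 2 : ℤ) : ℝ) * (g 0 0 ^ 2 + g 0 1 ^ 2)
      + 2 * ((-(ℓ * v 0) : ℤ) : ℝ) * (g 0 0 * g 1 0 + g 0 1 * g 1 1)
      + ((-v 1 : ℤ) : ℝ) * (g 1 0 ^ 2 + g 1 1 ^ 2) := by
    unfold sF; push_cast; rw [hNR]; field_simp; ring
  set α := alF (g 0 0) (g 0 1) (g 1 0) (g 1 1) (v 0) (v 1 / ℓ) (v 2 * m)
  set t := tF (g 0 0) (g 0 1) (g 1 0) (g 1 1) (v 0) (v 1 / ℓ) (v 2 * m)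
  set s := sF (g 0 0) (g 0 1) (g 1 0) (g 1 1) (v 0) (v 1 / ℓ) (v 2 * m)
  simp only [Matrix.cons_val_zero, Matrix.cons_val_one, Matrix.cons_val, Real.norm_eq_abs,
    abs_div, abs_mul, abs_of_pos hL, abs_of_pos hd] at n0 n1 n2
  rw [div_le_iff₀ (by positivity)] at n0 n1 n2
  have hHt : 0 ≤ ν * (ℓ * Hgt N g * d * L) := by positivity
  have hLt : 0 ≤ ν * (Real.sqrt ℓ * L) := by positivity
  by_cases hz : (ℓ : ℤ) * v 0 ^ 2 + m * v 1 * v 2 = 0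
  · have := height_form N hN hsf g hg (N * v 2) (-(ℓ * v 0)) (-v 1) ?_ ?_ ⟨_, rfl⟩
    · rw [← hs, abs_mul, abs_of_pos (by positivity : (0 : ℝ) < 2 * ℓ)] at this
      have h2 : Hgt N g * (2 * ℓ * |s|) ≤ Hgt N g * (2 * ℓ * (ν * (d * L))) := by gcongr
      linarith
    · rintro ⟨a1, a2, a3⟩
      apply hv
      have e2 : v 2 = 0 := by
        rcases mul_eq_zero.1 a1 with h | h
        · omega
        · exact h
      have e0 : v 0 = 0 := by
        rcases mul_eq_zero.1 (neg_eq_zero.1 a2) with h | h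
        · omega
        · exact h
      have e1 : v 1 = 0 := by omega
      funext i; fin_cases i
      · exact e0
      · exact e1
      · exact e2
    · rw [hNm]; push_cast; linear_combination (ℓ : ℤ) * hz
  · have h1 : (1 : ℝ) ≤ |(ℓ : ℝ) * v 0 ^ 2 + m * v 1 * v 2| := by
      exact_mod_cast Int.one_le_abs hz
    have e : (ℓ : ℝ) * v 0 ^ 2 + m * v 1 * v 2 = ℓ * (α ^ 2 + t ^ 2 - s ^ 2) := by
      rw [hdisc]; field_simp
    rw [e, abs_mul, abs_of_pos hlR] at h1
    have a2 : α ^ 2 ≤ (ν * L) ^ 2 := by rw [← sq_abs α]; gcongr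
    have t2 : t ^ 2 ≤ (ν * L) ^ 2 := by rw [← sq_abs t]; gcongr
    have s2 : s ^ 2 ≤ (ν * L) ^ 2 := by
      rw [← sq_abs s]; gcongr
      refine n2.trans ?_
      gcongr
      nlinarith
    have h3 : |α ^ 2 + t ^ 2 - s ^ 2| ≤ 2 * (ν * L) ^ 2 := by
      exact abs_disc_le a2 t2 s2
    have h4 : (1 : ℝ) ≤ ℓ * (2 * (ν * L) ^ 2) := h1.trans (by gcongr)
    have h5 : 1 ≤ 2 * (ν * (Real.sqrt ℓ * L)) := by
      apply one_le_of_sq (by positivity)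
      have : (2 * (ν * (Real.sqrt ℓ * L))) ^ 2 = 4 * (ℓ * (ν * L) ^ 2) := by
        have := Real.sq_sqrt hlR.le
        calc _ = 4 * (Real.sqrt ℓ ^ 2 * (ν * L) ^ 2) := by ring
          _ = _ := by rw [this]
      rw [this]
      have hmz : 0 ≤ (ℓ : ℝ) * (ν * L) ^ 2 := by positivity
      linarith only [hmz, h4]
    linarith

set_option maxHeartbeats 800000 in
lemma mu_bound (N ℓ m : ℕ) (hN : 0 < N) (hsf : Squarefree N) (hNm : N = ℓ * m) (hl : 0 < ℓ)
    (hm : 0 < m) (g : M2) (hg : g.det = 1) (hH : 0 < Hgt N g) (L d : ℝ) (hL : 0 < L) (hd : 0 < d)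
    (hd1 : d ≤ 1) (v : Z3) (hv : v ≠ 0) :
    1 ≤ ‖mapT (cofT (coordA ℓ m L d (g 0 0) (g 0 1) (g 1 0) (g 1 1))) v‖ *
      (3 * (ℓ / Real.sqrt m * L ^ 2 + ℓ * Hgt N g * d * L ^ 2)) := by
  have hlR : (0 : ℝ) < ℓ := by exact_mod_cast hl
  have hmR : (0 : ℝ) < m := by exact_mod_cast hm
  have hNR : (N : ℝ) = ℓ * m := by exact_mod_cast hNm
  have hg' : g 0 0 * g 1 1 - g 0 1 * g 1 0 = 1 := by
    rw [Matrix.det_fin_two] at hg; exact hg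
  have hdisc := form_disc (g 0 0) (g 0 1) (g 1 0) (g 1 1) (v 0 / 2) (v 2 / m) (ℓ * v 1) hg'
  have hT := coord_U ℓ m L d (g 0 0) (g 0 1) (g 1 0) (g 1 1) hlR.ne' hmR.ne' hL.ne' hd.ne' hg' v
  set ν := ‖mapT (cofT (coordA ℓ m L d (g 0 0) (g 0 1) (g 1 0) (g 1 1))) v‖ with hν
  have hνn : 0 ≤ ν := norm_nonneg _
  have n0 := norm_le_pi_norm (mapT (cofT (coordA ℓ m L d (g 0 0) (g 0 1) (g 1 0) (g 1 1))) v) 0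
  have n1 := norm_le_pi_norm (mapT (cofT (coordA ℓ m L d (g 0 0) (g 0 1) (g 1 0) (g 1 1))) v) 1
  have n2 := norm_le_pi_norm (mapT (cofT (coordA ℓ m L d (g 0 0) (g 0 1) (g 1 0) (g 1 1))) v) 2
  rw [← hν, hT] at n0 n1 n2
  have hs : ∀ B : ℤ, (m : ℤ) * v 0 = 2 * B →
    2 * (m : ℝ) * sF (g 0 0) (g 0 1) (g 1 0) (g 1 1) (v 0 / 2) (v 2 / m) (ℓ * v 1) =
    ((N * v 1 : ℤ) : ℝ) * (g 0 0 ^ 2 + g 0 1 ^ 2)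
      + 2 * ((-B : ℤ) : ℝ) * (g 0 0 * g 1 0 + g 0 1 * g 1 1)
      + ((-v 2 : ℤ) : ℝ) * (g 1 0 ^ 2 + g 1 1 ^ 2) := by
    intro B hB
    have hB' : (m : ℝ) * v 0 = 2 * B := by exact_mod_cast hB
    have e : 2 * (m : ℝ) * sF (g 0 0) (g 0 1) (g 1 0) (g 1 1) (v 0 / 2) (v 2 / m) (ℓ * v 1) =
      ((ℓ * m * v 1 : ℝ)) * (g 0 0 ^ 2 + g 0 1 ^ 2)
      - (m * v 0) * (g 0 0 * g 1 0 + g 0 1 * g 1 1)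
      - (v 2 : ℝ) * (g 1 0 ^ 2 + g 1 1 ^ 2) := by
      unfold sF; field_simp; ring
    rw [e, hB']; push_cast; rw [hNR]; ring
  set α := alF (g 0 0) (g 0 1) (g 1 0) (g 1 1) (v 0 / 2) (v 2 / m) (ℓ * v 1)
  set t := tF (g 0 0) (g 0 1) (g 1 0) (g 1 1) (v 0 / 2) (v 2 / m) (ℓ * v 1)
  set s := sF (g 0 0) (g 0 1) (g 1 0) (g 1 1) (v 0 / 2) (v 2 / m) (ℓ * v 1)
  simp only [Matrix.cons_val_zero, Matrix.cons_val_one, Matrix.cons_val, Real.norm_eq_abs,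
    abs_div, abs_mul, abs_neg, abs_pow, abs_of_pos hL, abs_of_pos hd, abs_of_pos hlR,
    abs_of_pos hmR] at n0 n1 n2
  rw [div_le_iff₀ (by positivity), div_mul_eq_mul_div, div_le_iff₀ hlR, mul_comm (m : ℝ),
    ← le_div_iff₀ hmR] at n0 n1 n2
  have hHt : 0 ≤ ν * (ℓ * Hgt N g * d * L ^ 2) := by positivity
  have hLt : 0 ≤ ν * (ℓ / Real.sqrt m * L ^ 2) := by positivity
  by_cases hz : (m : ℤ) * v 0 ^ 2 + 4 * ℓ * v 1 * v 2 = 0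
  · have hev : Even ((m : ℤ) * v 0) := by
      have : Even (((m : ℤ) * v 0) ^ 2) := by
        refine ⟨-2 * (m * ℓ * v 1 * v 2), ?_⟩
        linear_combination (m : ℤ) * hz
      exact (Int.even_pow.1 this).1
    obtain ⟨B, hB⟩ := hev
    have hB2 : (m : ℤ) * v 0 = 2 * B := by rw [hB]; ring
    have := height_form N hN hsf g hg (N * v 1) (-B) (-v 2) ?_ ?_ ⟨_, rfl⟩
    · rw [← hs B hB2, abs_mul, abs_of_pos (by positivity : (0 : ℝ) < 2 * m)] at this
      have hzR : (m : ℝ) * v 0 ^ 2 + 4 * ℓ * v 1 * v 2 = 0 := by exact_mod_cast hz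
      have e0 : α ^ 2 + t ^ 2 - s ^ 2 = 0 := by
        rw [hdisc]; field_simp; linear_combination hzR
      set Z := ν * (d * L ^ 2) * ℓ / m with hZ
      have hZ0 : 0 ≤ Z := by positivity
      have a2 : α ^ 2 ≤ Z ^ 2 := by rw [← sq_abs α]; gcongr
      have t2 : t ^ 2 ≤ Z ^ 2 := by rw [← sq_abs t]; gcongr
      have s2 : |s| ≤ 3 / 2 * Z := by
        apply abs_le_of_sq_le_sq _ (by positivity)
        nlinarith
      have h2 : Hgt N g * (2 * m * |s|) ≤ Hgt N g * (2 * m * (3 / 2 * Z)) := by gcongr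
      have h3 : Hgt N g * (2 * m * (3 / 2 * Z)) = 3 * (ν * (ℓ * Hgt N g * d * L ^ 2)) := by
        rw [hZ]; field_simp
      linarith
    · rintro ⟨a1, a2, a3⟩
      apply hv
      have e1 : v 1 = 0 := by
        rcases mul_eq_zero.1 a1 with h | h
        · omega
        · exact h
      have e0 : v 0 = 0 := by
        have : (m : ℤ) * v 0 = 0 := by omega
        rcases mul_eq_zero.1 this with h | h
        · omega
        · exact h
      have e2 : v 2 = 0 := by omega
      funext i; fin_cases i
      · exact e0
      · exact e1
      · exact e2
    · have h4 : (4 : ℤ) * (-B) ^ 2 = 4 * (N * v 1 * -v 2) := by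
        rw [hNm]; push_cast
        linear_combination (m : ℤ) * hz - (m * v 0 + 2 * B) * hB2
      linarith
  · have h1 : (1 : ℝ) ≤ |(m : ℝ) * v 0 ^ 2 + 4 * ℓ * v 1 * v 2| := by
      exact_mod_cast Int.one_le_abs hz
    have e : (m : ℝ) * v 0 ^ 2 + 4 * ℓ * v 1 * v 2 = 4 * m * (α ^ 2 + t ^ 2 - s ^ 2) := by
      rw [hdisc]; field_simp; ring
    rw [e, abs_mul, abs_of_pos (by positivity : (0 : ℝ) < 4 * m)] at h1
    set Z := ν * L ^ 2 * ℓ / m with hZ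
    have hZ0 : 0 ≤ Z := by positivity
    have hle : ν * (d * L ^ 2) * ℓ / m ≤ Z := by
      rw [hZ]; gcongr
      nlinarith [sq_nonneg L]
    have a2 : α ^ 2 ≤ Z ^ 2 := by rw [← sq_abs α]; gcongr; exact n0.trans hle
    have t2 : t ^ 2 ≤ Z ^ 2 := by rw [← sq_abs t]; gcongr; exact n1.trans hle
    have s2 : s ^ 2 ≤ Z ^ 2 := by rw [← sq_abs s]; gcongr
    have h3 : |α ^ 2 + t ^ 2 - s ^ 2| ≤ 2 * Z ^ 2 := by
      exact abs_disc_le a2 t2 s2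
    have h4 : (1 : ℝ) ≤ 4 * m * (2 * Z ^ 2) := h1.trans (by gcongr)
    have h5 : 1 ≤ 3 * (ν * (ℓ / Real.sqrt m * L ^ 2)) := by
      apply one_le_of_sq (by positivity)
      have : (3 * (ν * (ℓ / Real.sqrt m * L ^ 2))) ^ 2 = 9 * (m * Z ^ 2) := by
        have hsq := Real.sq_sqrt hmR.le
        calc _ = 9 * (ν * ℓ * L ^ 2) ^ 2 / Real.sqrt m ^ 2 := by
              field_simp; ring
          _ = _ := by rw [hsq, hZ]; field_simp
      rw [this]
      have hmz : 0 ≤ (m : ℝ) * Z ^ 2 := by positivity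
      linarith only [hmz, h4]
    linarith

/-- The conjugated matrix in terms of integral coordinates. -/
def gam (N ℓ m : ℕ) (g : M2) (v : Z3) : M2 :=
  let α := alF (g 0 0) (g 0 1) (g 1 0) (g 1 1) (v 0) (v 1 / ℓ) (v 2 * m)
  let t := tF (g 0 0) (g 0 1) (g 1 0) (g 1 1) (v 0) (v 1 / ℓ) (v 2 * m)
  let s := sF (g 0 0) (g 0 1) (g 1 0) (g 1 1) (v 0) (v 1 / ℓ) (v 2 * m)
  !![α, t - s; t + s, -α]

lemma exists_coord (N ℓ m : ℕ) (hNm : N = ℓ * m) (hl : 0 < ℓ) (g : M2) (hg : g.det = 1)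
    (γ : M2) (h1 : γ ∈ Rconj N ℓ g) (h2 : γ.trace = 0) : ∃ v : Z3, gam N ℓ m g v = γ := by
  have hlR : (0 : ℝ) < ℓ := by exact_mod_cast hl
  have hNR : (N : ℝ) = ℓ * m := by exact_mod_cast hNm
  have hu : IsUnit g.det := by rw [hg]; exact isUnit_one
  have hinv : g⁻¹ = !![g 1 1, -g 0 1; -g 1 0, g 0 0] := by
    rw [Matrix.inv_def, hg, Matrix.adjugate_fin_two]; simp
  have hγ : γ = g⁻¹ * (g * γ * g⁻¹) * g := by
    rw [Matrix.mul_assoc g, Matrix.nonsing_inv_mul_cancel_left _ _ hu, Matrix.mul_assoc,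
      Matrix.nonsing_inv_mul _ hu, Matrix.mul_one]
  have htr : (g * γ * g⁻¹).trace = 0 := by
    rw [Matrix.trace_mul_comm, Matrix.nonsing_inv_mul_cancel_left _ _ hu, h2]
  obtain ⟨⟨a, ha⟩, ⟨b, hb⟩, ⟨c, hc⟩, -⟩ := h1
  set X := g * γ * g⁻¹ with hX
  rw [Matrix.trace_fin_two] at htr
  have hd : X 1 1 = -a := by linarith
  have hc' : X 1 0 = c * m := by rw [hc, hNR]; field_simp
  refine ⟨![a, b, c], ?_⟩
  rw [hγ, hinv, Matrix.eta_fin_two X, ha, hb, hc', hd]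
  conv_rhs => rw [Matrix.eta_fin_two g]
  simp only [gam]
  ext i j
  fin_cases i <;> fin_cases j <;> simp [alF, tF, sF, Matrix.mul_apply, Fin.sum_univ_two] <;> ring

lemma coord_norm_le (N ℓ m : ℕ) (g : M2) (δ L : ℝ) (hδ : 0 < δ) (hL : 0 < L) (v : Z3)
    (h : gam N ℓ m g v ∈ PsiSet δ L) :
    ‖mapT (coordA ℓ m L (Real.sqrt δ) (g 0 0) (g 0 1) (g 1 0) (g 1 1)) v‖ ≤ 1 := by
  obtain ⟨h1, h2⟩ := h
  rw [coord_T]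
  simp only [gam, Pfun, Matrix.det_fin_two_of] at h1 h2
  set α := alF (g 0 0) (g 0 1) (g 1 0) (g 1 1) (v 0) (v 1 / ℓ) (v 2 * m)
  set t := tF (g 0 0) (g 0 1) (g 1 0) (g 1 1) (v 0) (v 1 / ℓ) (v 2 * m)
  set s := sF (g 0 0) (g 0 1) (g 1 0) (g 1 1) (v 0) (v 1 / ℓ) (v 2 * m)
  simp at h1 h2
  have hd := Real.sq_sqrt hδ.le
  have hdp := Real.sqrt_pos.2 hδ
  have a1 : |α| ≤ L := abs_le_of_sq_le_sq (by nlinarith [sq_nonneg t, sq_nonneg s]) hL.le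
  have t1 : |t| ≤ L := abs_le_of_sq_le_sq (by nlinarith [sq_nonneg α, sq_nonneg s]) hL.le
  have s1 : |s| ≤ Real.sqrt δ * L := by
    apply abs_le_of_sq_le_sq _ (by positivity)
    rw [mul_pow, hd]
    nlinarith
  rw [pi_norm_le_iff_of_nonneg zero_le_one]
  intro i
  fin_cases i
  · simp [abs_div, abs_of_pos hL]; exact (div_le_one hL).2 a1
  · simp [abs_div, abs_of_pos hL]; exact (div_le_one hL).2 t1
  · simp only [Fin.reduceFinMk, Matrix.cons_val, Real.norm_eq_abs]
    rw [abs_div, abs_of_pos (by positivity : 0 < Real.sqrt δ * L)]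
    exact (div_le_one (by positivity)).2 s1

/-- Counting trace-zero elements of R(ℓ;g) in Ψ(δ,L). -/
theorem stmt3 (ε : ℝ) (hε : 0 < ε) : ∃ C : ℝ, 0 < C ∧
    ∀ (N ℓ : ℕ) (g : M2) (δ L : ℝ), Squarefree N → 0 < N → 0 < ℓ → ℓ ∣ N →
    g.det = 1 → 0 < δ → δ ≤ 1 → 0 < L →
    {γ : M2 | γ ∈ Rconj N ℓ g ∧ γ.trace = 0 ∧ γ ∈ PsiSet δ L}.Finite ∧
    (({γ : M2 | γ ∈ Rconj N ℓ g ∧ γ.trace = 0 ∧ γ ∈ PsiSet δ L}.ncard : ℝ) ≤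
      C * ((N : ℝ) * (1 + L)) ^ ε *
        (1 + (Real.sqrt ℓ + (ℓ : ℝ) * Hgt N g * Real.sqrt δ) * L
          + ((ℓ : ℝ) ^ ((3 : ℝ) / 2) / Real.sqrt N
              + (ℓ : ℝ) ^ ((3 : ℝ) / 2) * Hgt N g * Real.sqrt δ) * L ^ 2
          + (ℓ : ℝ) ^ 2 / N * Real.sqrt δ * L ^ 3)) := by
  refine ⟨1000, by norm_num, ?_⟩
  intro N ℓ g δ L hsf hN hl hdvd hg hδ hδ1 hL
  obtain ⟨m, hNm⟩ := hdvd
  have hm : 0 < m := by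
    rcases Nat.eq_zero_or_pos m with h | h
    · subst h; simp at hNm; omega
    · exact h
  have hlR : (0 : ℝ) < ℓ := by exact_mod_cast hl
  have hl1 : (1 : ℝ) ≤ ℓ := by exact_mod_cast hl
  have hmR : (0 : ℝ) < m := by exact_mod_cast hm
  have hNR : (N : ℝ) = ℓ * m := by exact_mod_cast hNm
  have hN1 : (1 : ℝ) ≤ N := by exact_mod_cast hN
  have hH : 0 < Hgt N g := by
    have := height_form N hN hsf g hg 0 0 1 (by simp) (by simp) (by simp)
    by_contra hcon
    have h2 : Hgt N g * |((0 : ℤ) : ℝ) * (g 0 0 ^ 2 + g 0 1 ^ 2)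
      + 2 * ((0 : ℤ) : ℝ) * (g 0 0 * g 1 0 + g 0 1 * g 1 1)
      + ((1 : ℤ) : ℝ) * (g 1 0 ^ 2 + g 1 1 ^ 2)| ≤ 0 :=
      mul_nonpos_of_nonpos_of_nonneg (not_lt.1 hcon) (abs_nonneg _)
    linarith
  set d := Real.sqrt δ with hd
  have hdp : 0 < d := Real.sqrt_pos.2 hδ
  have hd1 : d ≤ 1 := Real.sqrt_le_one.2 hδ1
  have hg' : g 0 0 * g 1 1 - g 0 1 * g 1 0 = 1 := by
    rw [Matrix.det_fin_two] at hg; exact hg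
  set A := coordA ℓ m L d (g 0 0) (g 0 1) (g 1 0) (g 1 1) with hA
  have hdet : detT A = m / (2 * ℓ * d * L ^ 3) :=
    coord_det ℓ m L d _ _ _ _ hlR.ne' hL.ne' hdp.ne' hg'
  have hDpos : 0 < detT A := by rw [hdet]; positivity
  have hfin := mapT_finite A hDpos
  set F := hfin.toFinset with hF
  have hFm : ∀ v, v ∈ F ↔ ‖mapT A v‖ ≤ 1 := by intro v; simp [hF]
  have hsub : {γ : M2 | γ ∈ Rconj N ℓ g ∧ γ.trace = 0 ∧ γ ∈ PsiSet δ L} ⊆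
      (gam N ℓ m g) '' (F : Set Z3) := by
    rintro γ ⟨h1, h2, h3⟩
    obtain ⟨v, rfl⟩ := exists_coord N ℓ m hNm hl g hg γ h1 h2
    exact ⟨v, (hFm v).2 (coord_norm_le N ℓ m g δ L hδ hL v h3), rfl⟩
  have hfinI : ((gam N ℓ m g) '' (F : Set Z3)).Finite := F.finite_toSet.image _
  refine ⟨hfinI.subset hsub, ?_⟩
  have hcard : ({γ : M2 | γ ∈ Rconj N ℓ g ∧ γ.trace = 0 ∧ γ ∈ PsiSet δ L}.ncard : ℝ) ≤ F.card := by
    have h1 := Set.ncard_le_ncard hsub hfinI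
    have h2 := Set.ncard_image_le (f := gam N ℓ m g) F.finite_toSet
    rw [Set.ncard_coe_finset] at h2
    exact_mod_cast h1.trans h2
  set X1 := Real.sqrt ℓ * L + ℓ * Hgt N g * d * L with hX1
  set X2 := ℓ / Real.sqrt m * L ^ 2 + ℓ * Hgt N g * d * L ^ 2 with hX2
  have hX1p : 0 < X1 := by positivity
  have hX2p : 0 < X2 := by positivity
  have hcount := lattice_count (mapT A) (mapT (cofT A)) (detT A) (1 / (2 * X1)) (1 / (3 * X2))
    hDpos (by positivity) (by positivity) (mapT_cross A) (mapT_cof_cross A)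
    (fun v hv => by
      rw [div_le_iff₀ (by positivity)]
      exact lam_bound N ℓ m hN hsf hNm hl hm g hg hH L d hL hdp hd1 v hv)
    (fun v hv => by
      rw [div_le_iff₀ (by positivity)]
      exact mu_bound N ℓ m hN hsf hNm hl hm g hg hH L d hL hdp hd1 v hv) F hFm
  have hX3 : 1 / detT A = 2 * ((ℓ : ℝ) ^ 2 / N * d * L ^ 3) := by
    rw [hdet, hNR]; field_simp
  have hrhs : 1 + X1 + X2 + (ℓ : ℝ) ^ 2 / N * d * L ^ 3 ≤
      1 + (Real.sqrt ℓ + (ℓ : ℝ) * Hgt N g * d) * L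
          + ((ℓ : ℝ) ^ ((3 : ℝ) / 2) / Real.sqrt N
              + (ℓ : ℝ) ^ ((3 : ℝ) / 2) * Hgt N g * d) * L ^ 2
          + (ℓ : ℝ) ^ 2 / N * d * L ^ 3 := by
    have hp : (ℓ : ℝ) ^ ((3 : ℝ) / 2) = ℓ * Real.sqrt ℓ := by
      rw [show (3 : ℝ) / 2 = 1 + 1 / 2 by norm_num, Real.rpow_add hlR, Real.rpow_one,
        Real.sqrt_eq_rpow]
    have hs1 : 1 ≤ Real.sqrt ℓ := Real.one_le_sqrt.2 hl1
    have e1 : (ℓ : ℝ) ^ ((3 : ℝ) / 2) / Real.sqrt N = ℓ / Real.sqrt m := by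
      rw [hp, hNR, Real.sqrt_mul hlR.le]
      have : 0 < Real.sqrt ℓ := by positivity
      field_simp
    have e2 : ℓ * Hgt N g * d * L ^ 2 ≤ (ℓ : ℝ) ^ ((3 : ℝ) / 2) * Hgt N g * d * L ^ 2 := by
      rw [hp]; gcongr; nlinarith
    rw [e1, hX1, hX2]
    linarith
  have hpow : 1 ≤ ((N : ℝ) * (1 + L)) ^ ε := by
    apply Real.one_le_rpow _ hε.le
    nlinarith
  have hX3p : 0 ≤ (ℓ : ℝ) ^ 2 / N * d * L ^ 3 := by positivity
  set R := 1 + (Real.sqrt ℓ + (ℓ : ℝ) * Hgt N g * d) * L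
          + ((ℓ : ℝ) ^ ((3 : ℝ) / 2) / Real.sqrt N
              + (ℓ : ℝ) ^ ((3 : ℝ) / 2) * Hgt N g * d) * L ^ 2
          + (ℓ : ℝ) ^ 2 / N * d * L ^ 3 with hR
  have hRp : 0 ≤ R := by linarith
  have q1 : 4 / (1 / (2 * X1)) = 8 * X1 := by field_simp; norm_num
  have q2 : 96 / (1 / (3 * X2)) = 288 * X2 := by field_simp; norm_num
  have q3 : 384 / detT A = 768 * ((ℓ : ℝ) ^ 2 / N * d * L ^ 3) := by
    rw [div_eq_mul_one_div, hX3]; ring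
  rw [q1, q2, q3] at hcount
  calc _ ≤ (F.card : ℝ) := hcard
    _ ≤ 1000 * 1 * R := by linarith
    _ ≤ 1000 * ((N : ℝ) * (1 + L)) ^ ε * R := by gcongr
end
end

section
/- There is an absolute constant C > 0 with the following property. Let N be a squarefree positive integer, ℓ a positive divisor of N, δ ∈ (0,1], L > 0, and let z = x + iy ∈ ℍ satisfy Im(σ·z) ≤ y for all σ ∈ A₀(N). Put g = (√y, x/√y; 0, 1/√y) ∈ SL₂(ℝ), so that g·i = z. Then the set R(ℓ;g)⁰ ∩ Ψ(δ,L) is finite with cardinality at most C·(1 + ℓ·L/(N·y))·(1 + ℓ^{1/2}·N^{1/2}·y·L + ℓ·y·L²). -/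
open MeasureTheory Real Matrix Set

noncomputable section

lemma aux_prim (N : ℕ) (x y : ℝ) (hN : Squarefree N) (hN0 : 0 < N) (hy : 0 < y)
    (hz : ∀ σ ∈ AtkinLehner N, (moebius σ (x + y * Complex.I)).im ≤ y)
    (c d : ℤ) (hcd : IsCoprime c d) :
    ((Int.gcd c N : ℕ) : ℝ) ≤ N * ((c * x + d) ^ 2 + (c * y) ^ 2) := by
  obtain ⟨Q, hQ⟩ : Int.gcd c N ∣ N := by exact_mod_cast Int.gcd_dvd_right c (N : ℤ)
  obtain ⟨c', hc'⟩ : ((Int.gcd c N : ℕ) : ℤ) ∣ c := Int.gcd_dvd_left c (N : ℤ)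
  set q := Int.gcd c N with hq
  have hQ0 : 0 < Q := Nat.pos_of_ne_zero (by rintro rfl; simp at hQ; omega)
  have hq0 : 0 < q := Nat.pos_of_ne_zero (by rintro h; rw [h] at hQ; simp at hQ; omega)
  have hqQ : Nat.Coprime q Q := by
    rw [hQ] at hN
    exact Nat.coprime_of_squarefree_mul hN
  have hQc : IsCoprime (Q : ℤ) c := by
    rw [Int.isCoprime_iff_gcd_eq_one]
    have h1 : Int.gcd Q c ∣ Q := by exact_mod_cast Int.gcd_dvd_left (Q : ℤ) c
    have h2 : Int.gcd Q c ∣ q := by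
      apply Int.dvd_gcd
      · exact Int.gcd_dvd_right (Q : ℤ) c
      · exact_mod_cast h1.trans ⟨q, by rw [mul_comm]; exact hQ⟩
    have := Nat.dvd_gcd h2 h1
    rw [hqQ] at this
    exact Nat.dvd_one.mp this
  obtain ⟨a, b, hab⟩ : IsCoprime ((Q : ℤ) * d) c := IsCoprime.mul_left hQc hcd.symm
  have hQr : (0 : ℝ) < Q := by exact_mod_cast hQ0
  have hs : (0 : ℝ) < √(Q : ℝ) := Real.sqrt_pos.mpr hQr
  have hss : √(Q : ℝ) * √(Q : ℝ) = Q := Real.mul_self_sqrt hQr.le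
  have habr : (a : ℝ) * (Q * d) + b * c = 1 := by exact_mod_cast hab
  have hNr : (N : ℝ) = q * Q := by exact_mod_cast hQ
  have hcr : (c : ℝ) = q * c' := by exact_mod_cast hc'
  have hNc : (N : ℝ) * c' = Q * c := by rw [hNr, hcr]; ring
  set σ : M2 := (Real.sqrt Q)⁻¹ • !![(Q : ℝ) * (a : ℤ), ((-b : ℤ) : ℝ); (N : ℝ) * (c' : ℤ), (Q : ℝ) * (d : ℤ)] with hσ
  have e00 : σ 0 0 = √(Q : ℝ) * a := by
    simp [hσ]; rw [inv_mul_eq_iff_eq_mul₀ hs.ne']; rw [← mul_assoc, hss]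
  have e01 : σ 0 1 = - b / √(Q : ℝ) := by
    simp [hσ]; field_simp
  have e10 : σ 1 0 = √(Q : ℝ) * c := by
    simp [hσ]; rw [hNc, inv_mul_eq_iff_eq_mul₀ hs.ne']; rw [← mul_assoc, hss]
  have e11 : σ 1 1 = √(Q : ℝ) * d := by
    simp [hσ]; rw [inv_mul_eq_iff_eq_mul₀ hs.ne']; rw [← mul_assoc, hss]
  have hdet : σ.det = 1 := by
    rw [Matrix.det_fin_two, e00, e01, e10, e11]
    have : √(Q:ℝ) * a * (√(Q:ℝ) * d) - -b / √(Q:ℝ) * (√(Q:ℝ) * c) = (√(Q:ℝ) * √(Q:ℝ)) * a * d + b * c := by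
      field_simp
      ring
    rw [this, hss]; linarith
  have him := hz σ ⟨hdet, Q, a, -b, c', d, hQ0, ⟨q, by rw [mul_comm]; exact hQ⟩, hσ⟩
  have hcdpos : 0 < (c * x + d) ^ 2 + (c * y) ^ 2 := by
    by_cases hc : c = 0
    · have : d ≠ 0 := by
        rintro rfl; rw [hc, isCoprime_zero_left] at hcd; exact not_isUnit_zero hcd
      have : (d : ℝ) ≠ 0 := by exact_mod_cast this
      rw [hc]; simp; positivity
    · have : (c : ℝ) ≠ 0 := by exact_mod_cast hc
      positivity
  have hval : (moebius σ (x + y * Complex.I)).im = y / (Q * ((c * x + d) ^ 2 + (c * y) ^ 2)) := by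
    unfold moebius
    rw [Complex.div_im]
    have hns : Complex.normSq ((σ 1 0 : ℂ) * (x + y * Complex.I) + (σ 1 1 : ℂ)) = Q * ((c * x + d) ^ 2 + (c * y) ^ 2) := by
      rw [Complex.normSq_apply, e10, e11]
      simp
      linear_combination ((c * x + d) ^ 2 + (c * y) ^ 2) * hss
    rw [hns, ← sub_div]
    congr 1
    rw [Matrix.det_fin_two] at hdet
    simp
    linear_combination y * hdet
  rw [hval, div_le_iff₀ (by positivity)] at him
  have h1 : 1 ≤ Q * ((c * x + d) ^ 2 + (c * y) ^ 2) := by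
    by_contra h
    push Not at h
    nlinarith
  rw [hNr]
  have hqr : (0 : ℝ) < q := by exact_mod_cast hq0
  nlinarith

lemma aux_len (N ℓ : ℕ) (x y : ℝ) (hN : Squarefree N) (hN0 : 0 < N) (hlN : ℓ ∣ N) (hy : 0 < y)
    (hz : ∀ σ ∈ AtkinLehner N, (moebius σ (x + y * Complex.I)).im ≤ y)
    (c d : ℤ) (hcd : ¬ (c = 0 ∧ d = 0)) (hc : (ℓ : ℤ) ∣ c) :
    (ℓ : ℝ) ≤ N * ((c * x + d) ^ 2 + (c * y) ^ 2) := by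
  have hg : 0 < Int.gcd c d := by
    apply Nat.pos_of_ne_zero
    rw [Ne, Int.gcd_eq_zero_iff]
    exact hcd
  obtain ⟨c', hc'⟩ : ((Int.gcd c d : ℕ) : ℤ) ∣ c := Int.gcd_dvd_left c d
  obtain ⟨d', hd'⟩ : ((Int.gcd c d : ℕ) : ℤ) ∣ d := Int.gcd_dvd_right c d
  have hcop : IsCoprime c' d' := by
    rw [Int.isCoprime_iff_gcd_eq_one]
    have h := Int.gcd_mul_left (Int.gcd c d : ℤ) c' d'
    rw [← hc', ← hd'] at h
    simp at h
    have : (Int.gcd c d) * 1 = (Int.gcd c d) * Int.gcd c' d' := by rw [mul_one]; exact h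
    exact (Nat.eq_of_mul_eq_mul_left hg this).symm
  set h := Int.gcd c d with hh
  have hp := aux_prim N x y hN hN0 hy hz c' d' hcop
  have hdiv : ℓ ∣ h * Int.gcd c' N := by
    have h1 : ℓ ∣ Int.gcd (h * c') (h * N) := by
      apply Int.dvd_gcd
      · rw [← hc']; exact hc
      · exact_mod_cast hlN.mul_left h
    rw [Int.gcd_mul_left] at h1
    simpa using h1
  have hgp : 0 < Int.gcd c' N := Int.gcd_pos_of_ne_zero_right _ (by exact_mod_cast hN0.ne')
  have hle : ℓ ≤ h * Int.gcd c' N := Nat.le_of_dvd (by positivity) hdiv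
  have hler : (ℓ : ℝ) ≤ h * (Int.gcd c' N : ℕ) := by exact_mod_cast hle
  have hhr : (1 : ℝ) ≤ h := by exact_mod_cast hg
  have hcr : (c : ℝ) = h * c' := by exact_mod_cast hc'
  have hdr : (d : ℝ) = h * d' := by exact_mod_cast hd'
  have : N * ((c * x + d) ^ 2 + (c * y) ^ 2) = (h : ℝ) ^ 2 * (N * ((c' * x + d') ^ 2 + (c' * y) ^ 2)) := by
    rw [hcr, hdr]; ring
  rw [this]
  have hgr : (0 : ℝ) ≤ (Int.gcd c' N : ℕ) := by positivity
  calc (ℓ : ℝ) ≤ h * (Int.gcd c' N : ℕ) := hler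
    _ ≤ (h : ℝ) ^ 2 * (Int.gcd c' N : ℕ) := by
        apply mul_le_mul_of_nonneg_right _ hgr
        nlinarith
    _ ≤ _ := by gcongr

lemma aux_icc (S : Finset ℤ) (X Y : ℝ) (hX : 0 ≤ X + Y + 1) (h : ∀ k ∈ S, -Y ≤ (k : ℝ) ∧ (k : ℝ) ≤ X) :
    (S.card : ℝ) ≤ X + Y + 1 := by
  have hsub : S ⊆ Finset.Icc ⌈-Y⌉ ⌊X⌋ := by
    intro k hk
    rw [Finset.mem_Icc]
    exact ⟨Int.ceil_le.mpr (h k hk).1, Int.le_floor.mpr (h k hk).2⟩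
  have h1 := Finset.card_le_card hsub
  rw [Int.card_Icc] at h1
  have h2 : (S.card : ℝ) ≤ ((⌊X⌋ + 1 - ⌈-Y⌉).toNat : ℝ) := by exact_mod_cast h1
  have h3 : (((⌊X⌋ + 1 - ⌈-Y⌉).toNat : ℤ) : ℝ) ≤ X + Y + 1 := by
    rw [Int.toNat_eq_max]
    push_cast
    apply max_le _ hX
    linarith [Int.floor_le X, Int.le_ceil (-Y)]
  have h4 : (((⌊X⌋ + 1 - ⌈-Y⌉).toNat : ℤ) : ℝ) = ((⌊X⌋ + 1 - ⌈-Y⌉).toNat : ℝ) := by norm_cast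
  linarith

/-- planar lattice point count -/
lemma aux_count (T : Finset ℂ) (R D lam : ℝ) (hR : 0 < R) (hD : 0 < D) (hl : 0 < lam)
    (hT : ∀ w ∈ T, ‖w‖ ≤ R)
    (hsep : ∀ w ∈ T, ∀ w' ∈ T, w ≠ w' → lam ≤ ‖w - w'‖)
    (hdet : ∀ w ∈ T, ∀ w' ∈ T, ∀ u ∈ T, ∀ u' ∈ T, ∃ k : ℤ,
      ((w - w').im * (u - u').re - (w - w').re * (u - u').im) = k * D) :
    (T.card : ℝ) ≤ 2 + 4 * R / lam + 32 * R ^ 2 / D := by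
  classical
  by_cases hc : T.card ≤ 1
  · have : (T.card : ℝ) ≤ 1 := by exact_mod_cast hc
    have : 0 ≤ 4 * R / lam := by positivity
    have : 0 ≤ 32 * R ^ 2 / D := by positivity
    linarith
  push Not at hc
  obtain ⟨p, hp, p', hp', hpp⟩ := Finset.one_lt_card.mp hc
  obtain ⟨⟨u, u'⟩, huu, hmin⟩ := Finset.exists_min_image T.offDiag (fun v => ‖v.1 - v.2‖)
    ⟨(p, p'), by simp [hp, hp', hpp]⟩
  rw [Finset.mem_offDiag] at huu
  obtain ⟨hu, hu', hne⟩ := huu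
  simp only at hu hu' hne hmin
  set v := u - u' with hv
  set μ := ‖v‖ with hμ
  have hμl : lam ≤ μ := hsep u hu u' hu' hne
  have hμ0 : 0 < μ := lt_of_lt_of_le hl hμl
  have hμR : μ ≤ 2 * R := by
    have := norm_sub_le u u'
    linarith [hT u hu, hT u' hu']
  have hμsq : μ ^ 2 = v.re ^ 2 + v.im ^ 2 := by
    rw [hμ, Complex.sq_norm, Complex.normSq_apply]; ring
  have hex : ∀ w : ℂ, ∃ k : ℤ, w ∈ T → ((w - p).im * v.re - (w - p).re * v.im) = k * D := by
    intro w
    by_cases hw : w ∈ T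
    · obtain ⟨k, hk⟩ := hdet w hw p hp u hu u' hu'
      exact ⟨k, fun _ => hk⟩
    · exact ⟨0, fun h => absurd h hw⟩
  choose κ hκ using hex
  let t : ℂ → ℝ := fun w => ((w - p).re * v.re + (w - p).im * v.im) / μ ^ 2
  have hsq : ∀ a : ℂ, (a.re * v.re + a.im * v.im) ^ 2 + (a.im * v.re - a.re * v.im) ^ 2 = (‖a‖ * μ) ^ 2 := by
    intro a
    rw [mul_pow, hμsq, Complex.sq_norm, Complex.normSq_apply]; ring
  have hwp : ∀ w ∈ T, ‖w - p‖ ≤ 2 * R := by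
    intro w hw
    have := norm_sub_le w p
    linarith [hT w hw, hT p hp]
  have ht : ∀ w ∈ T, |t w| ≤ 2 * R / μ := by
    intro w hw
    have h1 : |(w - p).re * v.re + (w - p).im * v.im| ≤ ‖w - p‖ * μ := by
      apply abs_le_of_sq_le_sq _ (by positivity)
      nlinarith [hsq (w - p), sq_nonneg ((w - p).im * v.re - (w - p).re * v.im)]
    have h2 : |t w| = |(w - p).re * v.re + (w - p).im * v.im| / μ ^ 2 := by
      simp only [t]; rw [abs_div, abs_of_pos (by positivity : 0 < μ ^ 2)]
    rw [h2, div_le_div_iff₀ (by positivity) hμ0]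
    have h3 := hwp w hw
    have h4 : ‖w - p‖ * μ ≤ 2 * R * μ := by gcongr
    nlinarith
  have hk : ∀ w ∈ T, |(κ w : ℝ)| ≤ 2 * R * μ / D := by
    intro w hw
    have h1 : |(w - p).im * v.re - (w - p).re * v.im| ≤ ‖w - p‖ * μ := by
      apply abs_le_of_sq_le_sq _ (by positivity)
      nlinarith [hsq (w - p), sq_nonneg ((w - p).re * v.re + (w - p).im * v.im)]
    rw [hκ w hw, abs_mul, abs_of_pos hD] at h1
    rw [le_div_iff₀ hD]
    have h4 : ‖w - p‖ * μ ≤ 2 * R * μ := by gcongr; exact hwp w hw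
    linarith
  have hinj : Set.InjOn (fun w => (κ w, ⌊t w⌋)) (T : Set ℂ) := by
    intro w hw w' hw' h
    simp only [Prod.mk.injEq] at h
    by_contra hww
    have hm := hmin (w, w') (by rw [Finset.mem_offDiag]; exact ⟨hw, hw', hww⟩)
    simp only at hm
    have h1 := Int.abs_sub_lt_one_of_floor_eq_floor h.2
    have h2 := hκ w hw
    have h3 := hκ w' hw'
    rw [h.1] at h2
    have h4 : ((w - w').im * v.re - (w - w').re * v.im) = 0 := by
      simp only [Complex.sub_re, Complex.sub_im] at *
      linarith
    have h5 : t w - t w' = ((w - w').re * v.re + (w - w').im * v.im) / μ ^ 2 := by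
      simp only [t, Complex.sub_re, Complex.sub_im]
      ring
    rw [h5, abs_div, abs_of_pos (by positivity : 0 < μ ^ 2), div_lt_one (by positivity)] at h1
    have h6 := hsq (w - w')
    rw [h4] at h6
    have h7 : |(w - w').re * v.re + (w - w').im * v.im| = ‖w - w'‖ * μ := by
      rw [← abs_of_nonneg (by positivity : 0 ≤ ‖w - w'‖ * μ)]
      apply (sq_eq_sq_iff_abs_eq_abs _ _).mp
      linarith
    rw [h7] at h1
    nlinarith
  have hcard : T.card ≤ (T.image κ).card * (T.image (fun w => ⌊t w⌋)).card := by
    rw [← Finset.card_product, ← Finset.card_image_of_injOn hinj]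
    apply Finset.card_le_card
    intro q hq
    rw [Finset.mem_image] at hq
    obtain ⟨w, hw, rfl⟩ := hq
    rw [Finset.mem_product]
    exact ⟨Finset.mem_image_of_mem _ hw, Finset.mem_image_of_mem _ hw⟩
  have hA : ((T.image κ).card : ℝ) ≤ 2 * R * μ / D + 2 * R * μ / D + 1 := by
    apply aux_icc _ _ _ (by positivity)
    intro k hk'
    rw [Finset.mem_image] at hk'
    obtain ⟨w, hw, rfl⟩ := hk'
    exact abs_le.mp (hk w hw)
  have hB : ((T.image (fun w => ⌊t w⌋)).card : ℝ) ≤ 2 * R / μ + (2 * R / μ + 1) + 1 := by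
    apply aux_icc _ _ _ (by positivity)
    intro k hk'
    rw [Finset.mem_image] at hk'
    obtain ⟨w, hw, rfl⟩ := hk'
    have := abs_le.mp (ht w hw)
    constructor
    · linarith [Int.lt_floor_add_one (t w)]
    · linarith [Int.floor_le (t w)]
  have hcr : (T.card : ℝ) ≤ ((T.image κ).card : ℝ) * ((T.image (fun w => ⌊t w⌋)).card : ℝ) := by
    exact_mod_cast hcard
  calc (T.card : ℝ) ≤ _ := hcr
    _ ≤ (2 * R * μ / D + 2 * R * μ / D + 1) * (2 * R / μ + (2 * R / μ + 1) + 1) := by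
        gcongr
    _ = 2 + 4 * R / μ + 16 * R ^ 2 / D + 8 * R * μ / D := by
        field_simp
        ring
    _ ≤ 2 + 4 * R / lam + 16 * R ^ 2 / D + 8 * R * (2 * R) / D := by
        gcongr
    _ = _ := by ring

lemma aux_entries (N ℓ : ℕ) (x y : ℝ) (hy : 0 < y) (γ : M2)
    (h : γ ∈ Rconj N ℓ !![Real.sqrt y, x / Real.sqrt y; 0, (Real.sqrt y)⁻¹]) (htr : γ.trace = 0) :
    ∃ m a n : ℤ, γ 1 0 = y * (m * N / ℓ) ∧ γ 0 0 = a - m * N / ℓ * x ∧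
      y * γ 0 1 = n / ℓ + 2 * a * x - m * N / ℓ * x ^ 2 ∧ γ 1 1 = - γ 0 0 := by
  have hs : 0 < √y := Real.sqrt_pos.mpr hy
  have hss : √y ^ 2 = y := Real.sq_sqrt hy.le
  have hinv : (!![Real.sqrt y, x / Real.sqrt y; 0, (Real.sqrt y)⁻¹] : M2)⁻¹ =
      !![(√y)⁻¹, - (x / √y); 0, √y] := by
    apply Matrix.inv_eq_right_inv
    ext i j
    fin_cases i <;> fin_cases j <;> simp [Matrix.mul_apply, Fin.sum_univ_two, hs.ne']
    field_simp
    ring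
  unfold Rconj at h
  rw [Set.mem_ofPred_eq, hinv] at h
  obtain ⟨⟨a, ha⟩, ⟨n, hn⟩, ⟨m, hm⟩, -⟩ := h
  rw [Matrix.trace_fin_two] at htr
  simp [Matrix.mul_apply, Fin.sum_univ_two, Matrix.vecMul, dotProduct] at ha hn hm
  have h11 : γ 1 1 = - γ 0 0 := by linarith
  rw [h11] at hn
  have hc : γ 1 0 = y * (m * N / ℓ) := by
    rw [← hm]; field_simp; rw [hss]
  have hm' : (m * N / ℓ : ℝ) = γ 1 0 / y := by rw [hc]; field_simp
  refine ⟨m, a, n, hc, ?_, ?_, h11⟩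
  · rw [hm', ← ha]
    field_simp
    rw [hss]; field_simp; ring
  · rw [hm', ← ha, ← hn]
    field_simp
    rw [hss]; field_simp; ring

lemma aux_fiber (N ℓ : ℕ) (L x y : ℝ) (hN : Squarefree N) (hN0 : 0 < N) (hl0 : 0 < ℓ)
    (hlN : ℓ ∣ N) (hL : 0 < L) (hy : 0 < y)
    (hz : ∀ σ ∈ AtkinLehner N, (moebius σ (x + y * Complex.I)).im ≤ y)
    (F : Finset M2) (r : ℝ)
    (hF : ∀ γ ∈ F, γ ∈ Rconj N ℓ !![Real.sqrt y, x / Real.sqrt y; 0, (Real.sqrt y)⁻¹] ∧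
      γ.trace = 0 ∧ Pfun γ ≤ L ^ 2) (hr : ∀ γ ∈ F, γ 1 0 = r) :
    (F.card : ℝ) ≤ 2 + 8 * (√(ℓ : ℝ) * √(N : ℝ) * y * L) + 64 * ((ℓ : ℝ) * y * L ^ 2) := by
  classical
  have hlr : (0 : ℝ) < ℓ := by exact_mod_cast hl0
  have hNr : (0 : ℝ) < N := by exact_mod_cast hN0
  let W : M2 → ℂ := fun γ => ⟨y * γ 0 1, 2 * y * γ 0 0⟩
  have hdiff : ∀ γ ∈ F, ∀ γ' ∈ F, ∃ a n : ℤ, γ 0 0 - γ' 0 0 = a ∧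
      y * γ 0 1 - y * γ' 0 1 = n / ℓ + 2 * a * x := by
    intro γ h γ' h'
    obtain ⟨m, a, n, h1, h2, h3, -⟩ := aux_entries N ℓ x y hy γ (hF γ h).1 (hF γ h).2.1
    obtain ⟨m', a', n', h1', h2', h3', -⟩ := aux_entries N ℓ x y hy γ' (hF γ' h').1 (hF γ' h').2.1
    rw [hr γ h] at h1
    rw [hr γ' h', h1] at h1'
    have hmm := mul_left_cancel₀ hy.ne' h1'
    refine ⟨a - a', n - n', ?_, ?_⟩
    · rw [h2, h2', hmm]; push_cast; ring
    · rw [h3, h3', hmm]; push_cast; ring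
  have hWinj : Set.InjOn W (F : Set M2) := by
    intro γ h γ' h' hW
    have e1 : y * γ 0 1 = y * γ' 0 1 := congrArg Complex.re hW
    have e2 : 2 * y * γ 0 0 = 2 * y * γ' 0 0 := congrArg Complex.im hW
    have e01 := mul_left_cancel₀ hy.ne' e1
    have e00 := mul_left_cancel₀ (by positivity : (2 * y) ≠ 0) e2
    have t := (hF γ h).2.1
    have t' := (hF γ' h').2.1
    rw [Matrix.trace_fin_two] at t t'
    have e10 : γ 1 0 = γ' 1 0 := by rw [hr γ h, hr γ' h']
    ext i j
    fin_cases i <;> fin_cases j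
    · exact e00
    · exact e01
    · exact e10
    · show γ 1 1 = γ' 1 1
      linarith
  have hlam : 0 < 1 / (√(ℓ : ℝ) * √(N : ℝ)) := by positivity
  have hcnt := aux_count (F.image W) (2 * L * y) (2 * y / ℓ) (1 / (√(ℓ : ℝ) * √(N : ℝ)))
    (by positivity) (by positivity) hlam ?_ ?_ ?_
  · rw [Finset.card_image_of_injOn hWinj] at hcnt
    refine hcnt.trans (le_of_eq ?_)
    field_simp
    ring
  · intro w hw
    obtain ⟨γ, h, rfl⟩ := Finset.mem_image.mp hw
    have hP := (hF γ h).2.2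
    have t := (hF γ h).2.1
    rw [Matrix.trace_fin_two] at t
    have t' : γ 1 1 = - γ 0 0 := by linarith
    unfold Pfun at hP
    rw [t'] at hP
    apply le_of_sq_le_sq _ (by positivity)
    rw [Complex.sq_norm, Complex.normSq_apply]
    simp only [W]
    have h1 : (γ 0 1) ^ 2 + 4 * (γ 0 0) ^ 2 ≤ 4 * L ^ 2 := by
      nlinarith [sq_nonneg (γ 0 1), sq_nonneg (γ 1 0)]
    nlinarith [mul_le_mul_of_nonneg_left h1 (sq_nonneg y)]
  · intro w hw w' hw' hne
    obtain ⟨γ, h, rfl⟩ := Finset.mem_image.mp hw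
    obtain ⟨γ', h', rfl⟩ := Finset.mem_image.mp hw'
    obtain ⟨a, n, ha, hn⟩ := hdiff γ h γ' h'
    have hnz : ¬ (2 * a * (ℓ : ℤ) = 0 ∧ n = 0) := by
      rintro ⟨h1, h2⟩
      have h3 : a = 0 := by
        simpa [hl0.ne'] using h1
      rw [h3] at ha hn
      rw [h2] at hn
      simp at ha hn
      apply hne
      apply Complex.ext
      · show y * γ 0 1 = y * γ' 0 1
        linarith
      · show 2 * y * γ 0 0 = 2 * y * γ' 0 0
        rw [sub_eq_zero.mp ha]
    have hlen := aux_len N ℓ x y hN hN0 hlN hy hz (2 * a * ℓ) n hnz ⟨2 * a, by ring⟩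
    push_cast at hlen
    apply le_of_sq_le_sq _ (norm_nonneg _)
    rw [Complex.sq_norm, Complex.normSq_apply]
    have e1 : (W γ - W γ').re = n / ℓ + 2 * a * x := by rw [← hn]; rfl
    have e2 : (W γ - W γ').im = 2 * y * a := by rw [← ha, mul_sub]; rfl
    rw [e1, e2, div_pow, mul_pow, Real.sq_sqrt hlr.le, Real.sq_sqrt hNr.le,
      div_le_iff₀ (by positivity)]
    have : ((n / ℓ + 2 * a * x) * (n / ℓ + 2 * a * x) + 2 * y * a * (2 * y * a)) * ((ℓ : ℝ) * N)
      = (N * ((2 * a * ℓ * x + n) ^ 2 + (2 * a * ℓ * y) ^ 2)) / ℓ := by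
      field_simp
      ring
    rw [this, le_div_iff₀ hlr]
    linarith
  · intro w hw w' hw' u hu u' hu'
    obtain ⟨γ, h, rfl⟩ := Finset.mem_image.mp hw
    obtain ⟨γ', h', rfl⟩ := Finset.mem_image.mp hw'
    obtain ⟨η, k, rfl⟩ := Finset.mem_image.mp hu
    obtain ⟨η', k', rfl⟩ := Finset.mem_image.mp hu'
    obtain ⟨a, n, ha, hn⟩ := hdiff γ h γ' h'
    obtain ⟨b, s, hb, hs⟩ := hdiff η k η' k'
    have e1 : (W γ - W γ').re = n / ℓ + 2 * a * x := by rw [← hn]; rfl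
    have e2 : (W γ - W γ').im = 2 * y * a := by rw [← ha, mul_sub]; rfl
    have e3 : (W η - W η').re = s / ℓ + 2 * b * x := by rw [← hs]; rfl
    have e4 : (W η - W η').im = 2 * y * b := by rw [← hb, mul_sub]; rfl
    refine ⟨a * s - n * b, ?_⟩
    rw [e1, e2, e3, e4]
    push_cast
    field_simp
    ring

lemma aux_total (N ℓ : ℕ) (L x y : ℝ) (hN : Squarefree N) (hN0 : 0 < N) (hl0 : 0 < ℓ)
    (hlN : ℓ ∣ N) (hL : 0 < L) (hy : 0 < y)
    (hz : ∀ σ ∈ AtkinLehner N, (moebius σ (x + y * Complex.I)).im ≤ y)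
    (F : Finset M2)
    (hF : ∀ γ ∈ F, γ ∈ Rconj N ℓ !![Real.sqrt y, x / Real.sqrt y; 0, (Real.sqrt y)⁻¹] ∧
      γ.trace = 0 ∧ Pfun γ ≤ L ^ 2) :
    (F.card : ℝ) ≤ 256 * (1 + (ℓ : ℝ) * L / ((N : ℝ) * y)) *
        (1 + Real.sqrt ℓ * Real.sqrt N * y * L + (ℓ : ℝ) * y * L ^ 2) := by
  classical
  have hlr : (0 : ℝ) < ℓ := by exact_mod_cast hl0
  have hNr : (0 : ℝ) < N := by exact_mod_cast hN0
  have hex : ∀ γ : M2, ∃ m : ℤ, γ ∈ F → γ 1 0 = y * (m * N / ℓ) := by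
    intro γ
    by_cases h : γ ∈ F
    · obtain ⟨m, a, n, h1, -⟩ := aux_entries N ℓ x y hy γ (hF γ h).1 (hF γ h).2.1
      exact ⟨m, fun _ => h1⟩
    · exact ⟨0, fun h' => absurd h' h⟩
  choose m hm using hex
  set B : ℝ := 2 + 8 * (√(ℓ : ℝ) * √(N : ℝ) * y * L) + 64 * ((ℓ : ℝ) * y * L ^ 2) with hB
  have hB0 : 0 ≤ B := by positivity
  have hfib : ∀ k ∈ F.image m, (F.filter (fun γ => m γ = k)).card ≤ ⌊B⌋₊ := by
    intro k _
    apply Nat.le_floor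
    apply aux_fiber N ℓ L x y hN hN0 hl0 hlN hL hy hz _ (y * (k * N / ℓ))
    · intro γ h
      exact hF γ (Finset.mem_filter.mp h).1
    · intro γ h
      rw [Finset.mem_filter] at h
      rw [hm γ h.1, h.2]
  have hc := Finset.card_le_mul_card_image (s := F) (f := m) ⌊B⌋₊ hfib
  have hI : ((F.image m).card : ℝ) ≤ 2 * L * ℓ / (N * y) + 2 * L * ℓ / (N * y) + 1 := by
    apply aux_icc _ _ _ (by positivity)
    intro k hk
    obtain ⟨γ, h, rfl⟩ := Finset.mem_image.mp hk
    have hP := (hF γ h).2.2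
    unfold Pfun at hP
    have h1 : |γ 1 0| ≤ 2 * L := by
      apply abs_le_of_sq_le_sq _ (by positivity)
      nlinarith [sq_nonneg (γ 0 0), sq_nonneg (γ 0 1), sq_nonneg (γ 1 1)]
    rw [← abs_le]
    have h2 : (m γ : ℝ) = γ 1 0 * ℓ / (N * y) := by
      rw [hm γ h]; field_simp
    rw [h2, abs_div, abs_mul, abs_of_pos hlr, abs_of_pos (by positivity : 0 < (N : ℝ) * y)]
    gcongr
  have hcr : (F.card : ℝ) ≤ (⌊B⌋₊ : ℝ) * ((F.image m).card : ℝ) := by exact_mod_cast hc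
  have hfl := Nat.floor_le hB0
  calc (F.card : ℝ) ≤ (⌊B⌋₊ : ℝ) * ((F.image m).card : ℝ) := hcr
    _ ≤ B * (2 * L * ℓ / (N * y) + 2 * L * ℓ / (N * y) + 1) := by gcongr
    _ ≤ (64 * (1 + Real.sqrt ℓ * Real.sqrt N * y * L + (ℓ : ℝ) * y * L ^ 2)) *
        (4 * (1 + (ℓ : ℝ) * L / ((N : ℝ) * y))) := by
        have hp1 : 0 ≤ √(ℓ : ℝ) * √(N : ℝ) * y * L := by positivity
        have hp2 : 0 ≤ (ℓ : ℝ) * y * L ^ 2 := by positivity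
        have hp3 : 2 * L * ℓ / (N * y) = 2 * ((ℓ : ℝ) * L / ((N : ℝ) * y)) := by ring
        apply mul_le_mul _ _ (by positivity) (by positivity)
        · rw [hB]; linarith
        · rw [hp3]; linarith
    _ = _ := by ring

/-- Second count of R(ℓ;g)⁰ ∩ Ψ(δ,L) for g upper-triangular corresponding to
    z = x + iy with maximal imaginary part under A₀(N). -/
theorem stmt6 : ∃ C : ℝ, 0 < C ∧
    ∀ (N ℓ : ℕ) (δ L x y : ℝ), Squarefree N → 0 < N → 0 < ℓ → ℓ ∣ N →
    0 < δ → δ ≤ 1 → 0 < L → 0 < y →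
    (∀ σ ∈ AtkinLehner N, (moebius σ (x + y * Complex.I)).im ≤ y) →
    ∀ g : M2, g = !![Real.sqrt y, x / Real.sqrt y; 0, (Real.sqrt y)⁻¹] →
    {γ : M2 | γ ∈ Rconj N ℓ g ∧ γ.trace = 0 ∧ γ ∈ PsiSet δ L}.Finite ∧
    (({γ : M2 | γ ∈ Rconj N ℓ g ∧ γ.trace = 0 ∧ γ ∈ PsiSet δ L}.ncard : ℝ) ≤
      C * (1 + (ℓ : ℝ) * L / ((N : ℝ) * y)) *
        (1 + Real.sqrt ℓ * Real.sqrt N * y * L + (ℓ : ℝ) * y * L ^ 2)) := by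
  refine ⟨256, by norm_num, ?_⟩
  intro N ℓ δ L x y hN hN0 hl0 hlN _ _ hL hy hz g hg
  subst hg
  set S := {γ : M2 | γ ∈ Rconj N ℓ !![Real.sqrt y, x / Real.sqrt y; 0, (Real.sqrt y)⁻¹] ∧
    γ.trace = 0 ∧ γ ∈ PsiSet δ L} with hS
  have key : ∀ F : Finset M2, (F : Set M2) ⊆ S → (F.card : ℝ) ≤
      256 * (1 + (ℓ : ℝ) * L / ((N : ℝ) * y)) *
        (1 + Real.sqrt ℓ * Real.sqrt N * y * L + (ℓ : ℝ) * y * L ^ 2) := by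
    intro F hFS
    apply aux_total N ℓ L x y hN hN0 hl0 hlN hL hy hz F
    intro γ h
    have := hFS h
    exact ⟨this.1, this.2.1, this.2.2.1⟩
  have hfin : S.Finite := by
    by_contra hinf
    obtain ⟨F, hFS, hFc⟩ := Set.Infinite.exists_subset_card_eq hinf
      (⌊256 * (1 + (ℓ : ℝ) * L / ((N : ℝ) * y)) *
        (1 + Real.sqrt ℓ * Real.sqrt N * y * L + (ℓ : ℝ) * y * L ^ 2)⌋₊ + 1)
    have h1 := key F hFS
    rw [hFc] at h1
    push_cast at h1
    exact absurd h1 (not_le.mpr (Nat.lt_floor_add_one _))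
  refine ⟨hfin, ?_⟩
  rw [Set.ncard_eq_toFinset_card S hfin]
  exact key _ (by simp)
end
end

section
/- There is an absolute constant C > 0 such that for each j ∈ {0, 1, 2}, every t ∈ ℝ and every x > 0, the function x ↦ K_{it}(x) is j times differentiable and its j-th derivative satisfies |∂^j/∂x^j K_{it}(x)| ≤ C·(1 + |log x|)·((1+|t|)/x)^j·e^{−(π/2)|t|}. -/
open MeasureTheory Real Set

noncomputable section

/-- The modified Bessel function of imaginary order:
    K_{it}(x) = ∫₀^∞ e^{−x cosh u} cos(tu) du. -/
def Kit (t x : ℝ) : ℝ :=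
  ∫ u in Set.Ioi (0 : ℝ), Real.exp (-x * Real.cosh u) * Real.cos (t * u)


lemma aux_cosh_ge (u : ℝ) : 1 + u^2/4 ≤ Real.cosh u := by
  wlog hu : 0 ≤ u with H
  · have := H (-u) (by linarith); simpa using this
  have h1 := Real.quadratic_le_exp_of_nonneg hu
  have h2 := Real.add_one_le_exp (-u)
  rw [Real.cosh_eq]
  nlinarith

lemma aux_pow_exp (j : ℕ) {c : ℝ} (hc : 0 < c) (u : ℝ) :
    Real.cosh u ^ j * Real.exp (-c * Real.cosh u) ≤
      4 * ((j+1).factorial / c^(j+1)) * (1+u^2)⁻¹ := by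
  have hp := Real.cosh_pos u
  have h1 := Real.pow_div_factorial_le_exp (c * Real.cosh u) (by positivity) (j+1)
  have h2 := aux_cosh_ge u
  have hf : (0:ℝ) < (j+1).factorial := by positivity
  have he : Real.exp (-c * Real.cosh u) = (Real.exp (c * Real.cosh u))⁻¹ := by
    rw [← Real.exp_neg]; ring_nf
  have h3 : Real.cosh u ^ j * Real.exp (-c * Real.cosh u) ≤
      ((j+1).factorial / c^(j+1)) * (Real.cosh u)⁻¹ := by
    rw [he]
    have : (Real.exp (c * Real.cosh u))⁻¹ ≤ ((c * Real.cosh u)^(j+1) / (j+1).factorial)⁻¹ := by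
      gcongr
    calc _ ≤ Real.cosh u ^ j * ((c * Real.cosh u)^(j+1) / (j+1).factorial)⁻¹ := by gcongr
      _ = _ := by rw [mul_pow, inv_div, pow_succ (Real.cosh u)]; field_simp
  have h4 : (Real.cosh u)⁻¹ ≤ 4 * (1+u^2)⁻¹ := by
    have : (Real.cosh u)⁻¹ ≤ ((1 + u^2)/4)⁻¹ := by
      gcongr
      linarith
    simpa [div_eq_mul_inv, mul_comm] using this
  calc _ ≤ _ := h3
    _ ≤ ((j+1).factorial / c^(j+1)) * (4 * (1+u^2)⁻¹) := by gcongr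
    _ = _ := by ring

lemma aux_int (j : ℕ) {c : ℝ} (hc : 0 < c) :
    Integrable (fun u : ℝ => Real.cosh u ^ j * Real.exp (-c * Real.cosh u)) := by
  refine (integrable_inv_one_add_sq.const_mul (4 * ((j+1).factorial / c^(j+1)))).mono'
    (by apply Continuous.aestronglyMeasurable; fun_prop) (ae_of_all _ fun u => ?_)
  have hp := Real.cosh_pos u
  rw [Real.norm_of_nonneg (by positivity)]
  exact aux_pow_exp j hc u

lemma aux_even (j : ℕ) (c : ℝ) :
    ∫ u : ℝ, Real.cosh u ^ j * Real.exp (-c * Real.cosh u) =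
      2 * ∫ u in Ioi (0:ℝ), Real.cosh u ^ j * Real.exp (-c * Real.cosh u) := by
  rw [← integral_comp_abs (f := fun u => Real.cosh u ^ j * Real.exp (-c * Real.cosh u))]
  simp

lemma aux_M1 {c : ℝ} (hc : 0 < c) :
    ∫ u : ℝ, Real.cosh u ^ 1 * Real.exp (-c * Real.cosh u) ≤ 4 / c := by
  rw [aux_even]
  have hlim : Filter.Tendsto (fun u : ℝ => -(Real.exp (-c * Real.cosh u) / c)) Filter.atTop
      (nhds 0) := by
    have h1 : Filter.Tendsto (fun u : ℝ => Real.cosh u) Filter.atTop Filter.atTop := by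
      refine Filter.tendsto_atTop_mono (f := fun u : ℝ => u) (fun u => ?_) Filter.tendsto_id
      nlinarith [aux_cosh_ge u, sq_nonneg (u-2)]
    have h2 : Filter.Tendsto (fun u : ℝ => -c * Real.cosh u) Filter.atTop Filter.atBot :=
      h1.const_mul_atTop_of_neg (by linarith)
    have := ((Real.tendsto_exp_atBot.comp h2).div_const c).neg
    simpa using this
  have hd : ∀ u : ℝ, HasDerivAt (fun u : ℝ => -(Real.exp (-c * Real.cosh u) / c))
      (Real.sinh u * Real.exp (-c * Real.cosh u)) u := by
    intro u
    have := ((((Real.hasDerivAt_cosh u).const_mul (-c)).exp).div_const c).neg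
    refine HasDerivAt.congr_deriv this ?_
    rw [neg_eq_iff_eq_neg, div_eq_iff hc.ne']
    ring
  have hpos : ∀ u ∈ Ioi (0:ℝ), 0 ≤ Real.sinh u * Real.exp (-c * Real.cosh u) := by
    intro u hu
    have : 0 < Real.sinh u := Real.sinh_pos_iff.2 hu
    positivity
  have hi1 := integrableOn_Ioi_deriv_of_nonneg' (fun u _ => hd u) hpos hlim
  have he1 := integral_Ioi_of_hasDerivAt_of_tendsto' (fun u _ => hd u) hi1 hlim
  have hi2 : IntegrableOn (fun u : ℝ => (1/c) * Real.exp (-u)) (Ioi 0) :=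
    (integrableOn_exp_neg_Ioi 0).const_mul _
  have he2 : ∫ u in Ioi (0:ℝ), (1/c) * Real.exp (-u) = 1/c := by
    rw [integral_const_mul, integral_exp_neg_Ioi_zero]; simp
  have key : ∫ u in Ioi (0:ℝ), Real.cosh u ^ 1 * Real.exp (-c * Real.cosh u) ≤
      ∫ u in Ioi (0:ℝ), (Real.sinh u * Real.exp (-c * Real.cosh u) + (1/c) * Real.exp (-u)) := by
    refine setIntegral_mono_on (aux_int 1 hc).integrableOn (hi1.add hi2) measurableSet_Ioi ?_
    intro u hu
    have h1 : Real.cosh u = Real.sinh u + Real.exp (-u) := by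
      rw [Real.exp_neg, ← Real.exp_neg, ← Real.cosh_sub_sinh]; ring
    have h2 : Real.exp (-c * Real.cosh u) ≤ 1/c := by
      have a := Real.add_one_le_exp (c * Real.cosh u)
      have b := Real.one_le_cosh u
      have : Real.exp (-c * Real.cosh u) = 1 / (Real.exp (c * Real.cosh u)) := by
        rw [one_div, ← Real.exp_neg]; ring_nf
      rw [this]
      gcongr
      nlinarith
    have h3 : Real.exp (-c * Real.cosh u) * Real.exp (-u) ≤ (1/c) * Real.exp (-u) := by gcongr
    calc _ = Real.sinh u * Real.exp (-c * Real.cosh u) + Real.exp (-c * Real.cosh u) * Real.exp (-u) := by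
          rw [pow_one]; nth_rw 1 [h1]; ring
      _ ≤ _ := by gcongr
  rw [integral_add hi1 hi2, he1, he2] at key
  have : Real.exp (-c * Real.cosh 0) ≤ 1 := by
    rw [Real.exp_le_one_iff]; simp; linarith
  have h5 : Real.exp (-c * Real.cosh 0) / c ≤ 1 / c := by gcongr
  have : 4 / c = 2 * (1/c + 1/c) := by ring
  linarith

lemma aux_M2 {c : ℝ} (hc : 0 < c) :
    ∫ u : ℝ, Real.cosh u ^ 2 * Real.exp (-c * Real.cosh u) ≤ 16 / c^2 := by
  have h := aux_M1 (half_pos hc)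
  have key : ∫ u : ℝ, Real.cosh u ^ 2 * Real.exp (-c * Real.cosh u) ≤
      ∫ u : ℝ, (2/c) * (Real.cosh u ^ 1 * Real.exp (-(c/2) * Real.cosh u)) := by
    refine integral_mono (aux_int 2 hc) ((aux_int 1 (half_pos hc)).const_mul _) fun u => ?_
    have hp := Real.cosh_pos u
    have a := Real.add_one_le_exp (c/2 * Real.cosh u)
    have e1 : Real.exp (-c * Real.cosh u) =
        Real.exp (-(c/2) * Real.cosh u) * Real.exp (-(c/2) * Real.cosh u) := by
      rw [← Real.exp_add]; ring_nf
    have e2 : Real.exp (c/2 * Real.cosh u) * Real.exp (-(c/2) * Real.cosh u) = 1 := by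
      rw [← Real.exp_add]; ring_nf; simp
    have e3 : Real.cosh u * Real.exp (-(c/2) * Real.cosh u) ≤ 2/c := by
      rw [le_div_iff₀ hc]
      have := Real.exp_pos (-(c/2) * Real.cosh u)
      nlinarith
    calc _ = (Real.cosh u * Real.exp (-(c/2) * Real.cosh u)) * (Real.cosh u ^ 1 * Real.exp (-(c/2) * Real.cosh u)) := by
          simp only [e1]; ring
      _ ≤ _ := by gcongr
  rw [integral_const_mul] at key
  calc _ ≤ _ := key
    _ ≤ (2/c) * (4/(c/2)) := by gcongr
    _ = _ := by field_simp; norm_num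

lemma aux_M0 {x : ℝ} (hx : 0 < x) :
    ∫ u : ℝ, Real.cosh u ^ 0 * Real.exp (-x * Real.cosh u) ≤ 4 * (1 + |Real.log x|) := by
  rw [aux_even]
  set L := |Real.log x| with hL
  have hL0 : 0 ≤ L := abs_nonneg _
  have hi := (aux_int 0 hx)
  have hxL : Real.exp (-L) ≤ x := by
    rw [← Real.le_log_iff_exp_le hx]; exact neg_abs_le _
  rw [← Ioc_union_Ioi_eq_Ioi hL0, setIntegral_union (Ioc_disjoint_Ioi le_rfl) measurableSet_Ioi
    hi.integrableOn hi.integrableOn]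
  have h1 : ∫ u in Ioc 0 L, Real.cosh u ^ 0 * Real.exp (-x * Real.cosh u) ≤ ∫ u in Ioc 0 L, (1:ℝ) := by
    refine setIntegral_mono_on hi.integrableOn (by simp) measurableSet_Ioc fun u _ => ?_
    have := Real.cosh_pos u
    simp only [pow_zero, one_mul, Real.exp_le_one_iff]
    nlinarith
  have h2 : ∫ u in Ioi L, Real.cosh u ^ 0 * Real.exp (-x * Real.cosh u) ≤
      ∫ u in Ioi L, 2 * Real.exp L * Real.exp (-u) := by
    refine setIntegral_mono_on hi.integrableOn ((integrableOn_exp_neg_Ioi L).const_mul _) measurableSet_Ioi fun u _ => ?_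
    simp only [pow_zero, one_mul]
    have hc : Real.exp u / 2 ≤ Real.cosh u := by
      rw [Real.cosh_eq]; have := Real.exp_pos (-u); linarith
    have hp := Real.cosh_pos u
    have a := Real.add_one_le_exp (x * Real.cosh u)
    have b : Real.exp (-L) * (Real.exp u / 2) ≤ x * Real.cosh u := by gcongr
    have e : Real.exp (-x * Real.cosh u) = (Real.exp (x * Real.cosh u))⁻¹ := by
      rw [← Real.exp_neg]; ring_nf
    rw [e]
    calc _ ≤ (Real.exp (-L) * (Real.exp u / 2))⁻¹ := by
            gcongr
            linarith
      _ = _ := by rw [Real.exp_neg, Real.exp_neg]; field_simp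
  rw [integral_const_mul, integral_exp_neg_Ioi, mul_assoc, ← Real.exp_add] at h2
  simp at h1 h2
  replace h1 : ∫ (u : ℝ) in Ioc 0 L, rexp (-(x * cosh u)) ≤ L := h1.elim id fun h => h.trans hL0
  simp only [pow_zero, one_mul, neg_mul] at *
  linarith

def GG (t θ x u : ℝ) : ℂ :=
  Complex.exp (-(x:ℂ) * Complex.cosh (u + θ * Complex.I) + Complex.I * t * (u + θ * Complex.I))

lemma cosh_re' (u θ : ℝ) : (Complex.cosh (u + θ * Complex.I)).re = Real.cosh u * Real.cos θ := by
  rw [Complex.cosh_add, Complex.cosh_mul_I, Complex.sinh_mul_I, ← Complex.ofReal_cosh,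
    ← Complex.ofReal_sinh, ← Complex.ofReal_cos, ← Complex.ofReal_sin]
  simp only [Complex.add_re, Complex.add_im, Complex.mul_re, Complex.mul_im, Complex.ofReal_re,
    Complex.ofReal_im, Complex.I_re, Complex.I_im]
  ring

lemma cosh_im' (u θ : ℝ) : (Complex.cosh (u + θ * Complex.I)).im = Real.sinh u * Real.sin θ := by
  rw [Complex.cosh_add, Complex.cosh_mul_I, Complex.sinh_mul_I, ← Complex.ofReal_cosh,
    ← Complex.ofReal_sinh, ← Complex.ofReal_cos, ← Complex.ofReal_sin]
  simp only [Complex.add_re, Complex.add_im, Complex.mul_re, Complex.mul_im, Complex.ofReal_re,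
    Complex.ofReal_im, Complex.I_re, Complex.I_im]
  ring

lemma sinh_re' (u θ : ℝ) : (Complex.sinh (u + θ * Complex.I)).re = Real.sinh u * Real.cos θ := by
  rw [Complex.sinh_add, Complex.cosh_mul_I, Complex.sinh_mul_I, ← Complex.ofReal_cosh,
    ← Complex.ofReal_sinh, ← Complex.ofReal_cos, ← Complex.ofReal_sin]
  simp only [Complex.add_re, Complex.add_im, Complex.mul_re, Complex.mul_im, Complex.ofReal_re,
    Complex.ofReal_im, Complex.I_re, Complex.I_im]
  ring

lemma sinh_im' (u θ : ℝ) : (Complex.sinh (u + θ * Complex.I)).im = Real.cosh u * Real.sin θ := by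
  rw [Complex.sinh_add, Complex.cosh_mul_I, Complex.sinh_mul_I, ← Complex.ofReal_cosh,
    ← Complex.ofReal_sinh, ← Complex.ofReal_cos, ← Complex.ofReal_sin]
  simp only [Complex.add_re, Complex.add_im, Complex.mul_re, Complex.mul_im, Complex.ofReal_re,
    Complex.ofReal_im, Complex.I_re, Complex.I_im]
  ring

lemma norm_cosh_le (u θ : ℝ) : ‖Complex.cosh (u + θ * Complex.I)‖ ≤ Real.cosh u := by
  refine abs_le_of_sq_le_sq' ?_ (Real.cosh_pos u).le |>.2
  rw [Complex.sq_norm, Complex.normSq_apply, cosh_re', cosh_im']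
  nlinarith [Real.sin_sq_add_cos_sq θ, Real.cosh_sq u, sq_nonneg (Real.sin θ)]

lemma norm_sinh_le (u θ : ℝ) : ‖Complex.sinh (u + θ * Complex.I)‖ ≤ Real.cosh u := by
  refine abs_le_of_sq_le_sq' ?_ (Real.cosh_pos u).le |>.2
  rw [Complex.sq_norm, Complex.normSq_apply, sinh_re', sinh_im']
  nlinarith [Real.sin_sq_add_cos_sq θ, Real.cosh_sq u, sq_nonneg (Real.cos θ)]

lemma norm_GG (t θ x u : ℝ) :
    ‖GG t θ x u‖ = Real.exp (-(t*θ)) * Real.exp (-(x * Real.cos θ) * Real.cosh u) := by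
  rw [GG, Complex.norm_exp, ← Real.exp_add]
  congr 1
  simp only [Complex.add_re, Complex.neg_re, neg_mul, Complex.re_ofReal_mul, cosh_re']
  simp
  ring

lemma GG_cont (t θ x : ℝ) : Continuous (GG t θ x) := by
  unfold GG
  have := Complex.continuous_cosh
  fun_prop

lemma coshc_cont (θ : ℝ) : Continuous (fun u : ℝ => Complex.cosh (u + θ * Complex.I)) := by
  have := Complex.continuous_cosh
  fun_prop

lemma sinhc_cont (θ : ℝ) : Continuous (fun u : ℝ => Complex.sinh (u + θ * Complex.I)) := by
  have := Complex.continuous_sinh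
  fun_prop

/-- integrand of the j-th derivative -/
def HH (j : ℕ) (t θ x u : ℝ) : ℂ := (-Complex.cosh (u + θ * Complex.I))^j * GG t θ x u

lemma HH_cont (j : ℕ) (t θ x : ℝ) : Continuous (HH j t θ x) :=
  ((coshc_cont θ).neg.pow j).mul (GG_cont t θ x)

lemma norm_HH_le (j : ℕ) (t θ x u : ℝ) : ‖HH j t θ x u‖ ≤
    Real.exp (-(t*θ)) * (Real.cosh u ^ j * Real.exp (-(x * Real.cos θ) * Real.cosh u)) := by
  rw [HH, norm_mul, norm_pow, norm_neg, norm_GG]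
  have := norm_cosh_le u θ
  calc _ ≤ Real.cosh u ^ j * (Real.exp (-(t*θ)) * Real.exp (-(x * Real.cos θ) * Real.cosh u)) := by gcongr
    _ = _ := by ring

lemma HH_int (j : ℕ) (t : ℝ) {θ x : ℝ} (hx : 0 < x) (hθ : 0 < Real.cos θ) :
    Integrable (HH j t θ x) :=
  ((aux_int j (mul_pos hx hθ)).const_mul _).mono' (HH_cont j t θ x).aestronglyMeasurable
    (ae_of_all _ fun u => norm_HH_le j t θ x u)

lemma norm_JJ_le (j : ℕ) (t : ℝ) {θ x : ℝ} (hx : 0 < x) (hθ : 0 < Real.cos θ) :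
    ‖∫ u, HH j t θ x u‖ ≤
      Real.exp (-(t*θ)) * ∫ u, Real.cosh u ^ j * Real.exp (-(x * Real.cos θ) * Real.cosh u) := by
  rw [← integral_const_mul]
  exact norm_integral_le_of_norm_le ((aux_int j (mul_pos hx hθ)).const_mul _)
    (ae_of_all _ fun u => norm_HH_le j t θ x u)

lemma JJ_deriv (j : ℕ) (t : ℝ) {θ x : ℝ} (hx : 0 < x) (hθ : 0 < Real.cos θ) :
    HasDerivAt (fun y => ∫ u, HH j t θ y u) (∫ u, HH (j+1) t θ x u) x := by
  refine (hasDerivAt_integral_of_dominated_loc_of_deriv_le (s := Ioi (x/2))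
    (bound := fun u => Real.exp (-(t*θ)) *
      (Real.cosh u ^ (j+1) * Real.exp (-((x/2) * Real.cos θ) * Real.cosh u)))
    (F' := fun y u => HH (j+1) t θ y u)
    (Ioi_mem_nhds (by linarith)) (Filter.Eventually.of_forall fun y =>
    (HH_cont j t θ y).aestronglyMeasurable) (HH_int j t hx hθ)
    (HH_cont (j+1) t θ x).aestronglyMeasurable (ae_of_all _ fun u y hy => ?_)
    ((aux_int (j+1) (mul_pos (half_pos hx) hθ)).const_mul _) (ae_of_all _ fun u y hy => ?_)).2
  · refine (norm_HH_le (j+1) t θ y u).trans ?_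
    have hp := Real.cosh_pos u
    have hy' : x / 2 < y := hy
    gcongr
  · unfold HH GG
    have h1 : HasDerivAt (fun y : ℝ => (y:ℂ)) 1 y := Complex.ofRealCLM.hasDerivAt
    have h2 := (((h1.neg.mul_const (Complex.cosh (u + θ * Complex.I))).add_const
      (Complex.I * t * (u + θ * Complex.I))).cexp).const_mul ((-Complex.cosh (u + θ * Complex.I))^j)
    refine HasDerivAt.congr_deriv h2 ?_
    simp only [Pi.neg_apply]
    ring

/-- derivative of the integrand in the complex variable -/
def DD (t θ x u : ℝ) : ℂ :=
  (-(x:ℂ) * Complex.sinh (u + θ * Complex.I) + Complex.I * t) * GG t θ x u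

lemma DD_cont (t θ x : ℝ) : Continuous (DD t θ x) :=
  ((continuous_const.mul (sinhc_cont θ)).add continuous_const).mul (GG_cont t θ x)

lemma norm_DD_le (t θ : ℝ) {x : ℝ} (hx : 0 < x) (u : ℝ) : ‖DD t θ x u‖ ≤
    Real.exp (-(t*θ)) * ((x + |t|) * (Real.cosh u ^ 1 * Real.exp (-(x * Real.cos θ) * Real.cosh u))) := by
  rw [DD, norm_mul, norm_GG]
  have h1 := norm_sinh_le u θ
  have h2 := Real.one_le_cosh u
  have : ‖-(x:ℂ) * Complex.sinh (u + θ * Complex.I) + Complex.I * t‖ ≤ (x + |t|) * Real.cosh u := by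
    refine (norm_add_le _ _).trans ?_
    rw [norm_mul, norm_mul, norm_neg, Complex.norm_real, Complex.norm_real, Complex.norm_I,
      Real.norm_of_nonneg hx.le, Real.norm_eq_abs]
    nlinarith [abs_nonneg t]
  calc _ ≤ ((x + |t|) * Real.cosh u) * (Real.exp (-(t*θ)) * Real.exp (-(x * Real.cos θ) * Real.cosh u)) := by gcongr
    _ = _ := by ring

lemma DD_int (t : ℝ) {θ x : ℝ} (hx : 0 < x) (hθ : 0 < Real.cos θ) :
    Integrable (DD t θ x) :=
  (((aux_int 1 (mul_pos hx hθ)).const_mul _).const_mul _).mono' (DD_cont t θ x).aestronglyMeasurable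
    (ae_of_all _ fun u => norm_DD_le t θ hx u)

lemma GG_int (t : ℝ) {θ x : ℝ} (hx : 0 < x) (hθ : 0 < Real.cos θ) :
    Integrable (GG t θ x) := by
  have := HH_int 0 t hx hθ
  unfold HH at this
  simpa using this

lemma GG_deriv_z (t x : ℝ) (z : ℂ) :
    HasDerivAt (fun z : ℂ => Complex.exp (-(x:ℂ) * Complex.cosh z + Complex.I * t * z))
      ((-(x:ℂ) * Complex.sinh z + Complex.I * t) *
        Complex.exp (-(x:ℂ) * Complex.cosh z + Complex.I * t * z)) z := by
  have := (((Complex.hasDerivAt_cosh z).const_mul (-(x:ℂ))).add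
    ((hasDerivAt_id z).const_mul (Complex.I * t))).cexp
  refine HasDerivAt.congr_deriv this ?_
  simp
  ring

lemma GG_deriv_u (t θ x u : ℝ) : HasDerivAt (GG t θ x) (DD t θ x u) u := by
  have h1 : HasDerivAt (fun u : ℝ => (u:ℂ) + θ * Complex.I) 1 u :=
    Complex.ofRealCLM.hasDerivAt.add_const _
  have := (GG_deriv_z t x (u + θ * Complex.I)).comp u h1
  rw [mul_one] at this
  exact this

lemma GG_deriv_θ (t θ x u : ℝ) : HasDerivAt (fun θ => GG t θ x u) (Complex.I * DD t θ x u) θ := by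
  have h1 : HasDerivAt (fun θ : ℝ => (u:ℂ) + θ * Complex.I) (1 * Complex.I) θ :=
    (Complex.ofRealCLM.hasDerivAt.mul_const Complex.I).const_add _
  have := (GG_deriv_z t x (u + θ * Complex.I)).comp θ h1
  exact HasDerivAt.congr_deriv this (by unfold DD GG; ring)

lemma DD_zero (t : ℝ) {θ x : ℝ} (hx : 0 < x) (hθ : 0 < Real.cos θ) : ∫ u, DD t θ x u = 0 :=
  integral_eq_zero_of_hasDerivAt_of_integrable (GG_deriv_u t θ x) (DD_int t hx hθ) (GG_int t hx hθ)

lemma shift_deriv (t : ℝ) {θ x : ℝ} (hx : 0 < x) (h0 : -(π/2) < θ) (h1 : θ < π/2) :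
    HasDerivAt (fun θ => ∫ u, GG t θ x u) 0 θ := by
  have hcos : 0 < Real.cos θ := Real.cos_pos_of_mem_Ioo ⟨h0, h1⟩
  have key := (hasDerivAt_integral_of_dominated_loc_of_deriv_le (x₀ := θ)
    (F := fun θ u => GG t θ x u) (μ := volume)
    (s := {η | Real.cos θ / 2 < Real.cos η} ∩ Ioo (-(π/2)) (π/2))
    (bound := fun u => Real.exp (|t| * (π/2)) * ((x + |t|) *
      (Real.cosh u ^ 1 * Real.exp (-(x * (Real.cos θ / 2)) * Real.cosh u))))
    (F' := fun η u => Complex.I * DD t η x u)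
    (Filter.inter_mem ((isOpen_lt continuous_const Real.continuous_cos).mem_nhds (by
      show Real.cos θ / 2 < Real.cos θ
      linarith))
      (Ioo_mem_nhds h0 h1)) (Filter.Eventually.of_forall fun y =>
    (GG_cont t y x).aestronglyMeasurable) (GG_int t hx hcos)
    (continuous_const.mul (DD_cont t θ x)).aestronglyMeasurable (ae_of_all _ fun u y hy => ?_)
    (((aux_int 1 (mul_pos hx (half_pos hcos))).const_mul _).const_mul _)
    (ae_of_all _ fun u y hy => GG_deriv_θ t y x u)).2
  · rw [integral_const_mul, DD_zero t hx hcos, mul_zero] at key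
    exact key
  · rw [norm_mul, Complex.norm_I, one_mul]
    refine (norm_DD_le t y hx u).trans ?_
    have hp := Real.cosh_pos u
    have hy1 : Real.cos θ / 2 < Real.cos y := hy.1
    have hy2 : |y| ≤ π/2 := abs_le.2 ⟨hy.2.1.le, hy.2.2.le⟩
    have : -(t*y) ≤ |t| * (π/2) :=
      calc -(t*y) ≤ |t*y| := neg_le_abs _
        _ = |t| * |y| := abs_mul _ _
        _ ≤ _ := by gcongr
    gcongr

lemma shift (t : ℝ) {θ x : ℝ} (hx : 0 < x) (h0 : 0 ≤ θ) (h1 : θ < π/2) :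
    ∫ u, GG t θ x u = ∫ u, GG t 0 x u := by
  refine constant_of_has_deriv_right_zero (f := fun θ => ∫ u, GG t θ x u) (a := 0) (b := θ)
    (fun y hy => ?_) (fun y hy => ?_) θ ⟨h0, le_rfl⟩
  · exact (shift_deriv t hx (by linarith [hy.1, Real.pi_pos]) (by linarith [hy.2])).continuousAt.continuousWithinAt
  · exact (shift_deriv t hx (by linarith [hy.1, Real.pi_pos]) (by linarith [hy.2])).hasDerivWithinAt

lemma Kit_abs (t x : ℝ) : Kit |t| x = Kit t x := by
  rcases abs_cases t with ⟨h, _⟩ | ⟨h, _⟩ <;> simp [h, Kit]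

lemma Kit_eq (t : ℝ) {θ x : ℝ} (hx : 0 < x) (h0 : 0 ≤ θ) (h1 : θ < π/2) :
    Kit t x = (∫ u, HH 0 t θ x u).re / 2 := by
  have e : ∀ u, HH 0 t θ x u = GG t θ x u := fun u => by simp [HH]
  simp only [e]
  rw [shift t hx h0 h1]
  have hi := GG_int t hx (θ := 0) (by simp)
  have h2 : (∫ u, GG t 0 x u).re = ∫ u, (GG t 0 x u).re := by
    have := Complex.reCLM.integral_comp_comm hi
    simpa using this.symm
  have h3 : ∀ u, (GG t 0 x u).re = Real.exp (-x * Real.cosh |u|) * Real.cos (t * |u|) := by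
    intro u
    have hc : Real.cos (t * |u|) = Real.cos (t*u) := by
      rcases abs_cases u with ⟨h, _⟩ | ⟨h, _⟩ <;> simp [h]
    have : GG t 0 x u = Complex.exp (((-x * Real.cosh u : ℝ) : ℂ) + ((t * u : ℝ):ℂ) * Complex.I) := by
      unfold GG
      congr 1
      push_cast
      simp only [zero_mul, add_zero]
      ring
    rw [this, hc, Real.cosh_abs, Complex.exp_re]
    congr 2 <;> simp
  rw [h2]
  simp only [h3]
  rw [integral_comp_abs (f := fun u => Real.exp (-x * Real.cosh u) * Real.cos (t * u))]
  simp [Kit]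

lemma Kit_deriv (t : ℝ) {θ x : ℝ} (hx : 0 < x) (h0 : 0 ≤ θ) (h1 : θ < π/2) :
    HasDerivAt (fun y => Kit t y) ((∫ u, HH 1 t θ x u).re / 2) x := by
  have hcos : 0 < Real.cos θ := Real.cos_pos_of_mem_Ioo ⟨by linarith [Real.pi_pos], h1⟩
  have h := (Complex.reCLM.hasFDerivAt.comp_hasDerivAt x (JJ_deriv 0 t hx hcos)).div_const 2
  refine h.congr_of_eventuallyEq ?_
  filter_upwards [Ioi_mem_nhds hx] with y hy
  exact Kit_eq t hy h0 h1

lemma Kit_deriv2 (t : ℝ) {θ x : ℝ} (hx : 0 < x) (h0 : 0 ≤ θ) (h1 : θ < π/2) :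
    HasDerivAt (deriv (fun y => Kit t y)) ((∫ u, HH 2 t θ x u).re / 2) x := by
  have hcos : 0 < Real.cos θ := Real.cos_pos_of_mem_Ioo ⟨by linarith [Real.pi_pos], h1⟩
  have h := (Complex.reCLM.hasFDerivAt.comp_hasDerivAt x (JJ_deriv 1 t hx hcos)).div_const 2
  refine h.congr_of_eventuallyEq ?_
  filter_upwards [Ioi_mem_nhds hx] with y hy
  exact (Kit_deriv t hy h0 h1).deriv

lemma re_half_le {z : ℂ} {B : ℝ} (h : ‖z‖ ≤ B) : |z.re / 2| ≤ B := by
  have := Complex.abs_re_le_norm z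
  rw [abs_div, abs_two]
  linarith [abs_nonneg z.re]

lemma J0_ibp {t θ x : ℝ} (ht : 0 < t) (hx : 0 < x) (hθ : 0 < Real.cos θ) :
    ‖∫ u, HH 0 t θ x u‖ ≤ (x / t) * (Real.exp (-(t*θ)) * (4 / (x * Real.cos θ))) := by
  have e : ∀ u, HH 0 t θ x u = GG t θ x u := fun u => by simp [HH]
  simp only [e]
  have hd := DD_zero t hx hθ
  have hs : ∫ u, (DD t θ x u - Complex.I * t * GG t θ x u) = - (Complex.I * t * ∫ u, GG t θ x u) := by
    rw [integral_sub (DD_int t hx hθ) ((GG_int t hx hθ).const_mul _), hd, integral_const_mul]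
    ring
  have hb : ‖∫ u, (DD t θ x u - Complex.I * t * GG t θ x u)‖ ≤ ∫ u, x * (Real.exp (-(t*θ)) *
      (Real.cosh u ^ 1 * Real.exp (-(x * Real.cos θ) * Real.cosh u))) := by
    refine norm_integral_le_of_norm_le (((aux_int 1 (mul_pos hx hθ)).const_mul _).const_mul _)
      (ae_of_all _ fun u => ?_)
    have : DD t θ x u - Complex.I * t * GG t θ x u =
      -(x:ℂ) * Complex.sinh (u + θ * Complex.I) * GG t θ x u := by unfold DD; ring
    rw [this, norm_mul, norm_mul, norm_neg, Complex.norm_real, Real.norm_of_nonneg hx.le, norm_GG]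
    have h1 := norm_sinh_le u θ
    calc _ ≤ x * Real.cosh u * (Real.exp (-(t*θ)) * Real.exp (-(x * Real.cos θ) * Real.cosh u)) := by gcongr
      _ = _ := by ring
  rw [hs, norm_neg, norm_mul, norm_mul, Complex.norm_I, Complex.norm_real,
    Real.norm_of_nonneg ht.le, one_mul, integral_const_mul, integral_const_mul] at hb
  have hM := aux_M1 (mul_pos hx hθ)
  have : t * ‖∫ u, GG t θ x u‖ ≤ x * (Real.exp (-(t*θ)) * (4 / (x * Real.cos θ))) :=
    hb.trans (by gcongr)
  rw [div_mul_eq_mul_div, le_div_iff₀ ht]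
  linarith

lemma main_bound {t x : ℝ} (ht : 0 ≤ t) (hx : 0 < x) : ∃ θ, 0 ≤ θ ∧ θ < π/2 ∧
    ∀ j : ℕ, j ≤ 2 → ‖∫ u, HH j t θ x u‖ ≤
      16 * Real.exp 2 * 4 * (1 + |Real.log x|) * ((1 + t)/x)^j * Real.exp (-(π/2) * t) := by
  have hpi := Real.pi_pos
  have hpi3 := Real.pi_gt_three
  have hpi4 := Real.pi_le_four
  have hl : 1 ≤ 1 + |Real.log x| := by linarith [abs_nonneg (Real.log x)]
  rcases lt_or_ge t 1 with h | h
  · refine ⟨0, le_rfl, by positivity, ?_⟩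
    have hex : 1 ≤ Real.exp 2 * Real.exp (-(π/2)*t) := by
      rw [← Real.exp_add]
      apply Real.one_le_exp
      nlinarith
    have hc : 0 < Real.cos 0 := by simp
    have A : ∀ j, ‖∫ u, HH j t 0 x u‖ ≤ ∫ u, Real.cosh u ^ j * Real.exp (-x * Real.cosh u) := by
      intro j
      have := norm_JJ_le j t hx hc
      simpa using this
    have B : ∀ j, (1/x)^j ≤ ((1+t)/x)^j := by
      intro j; gcongr; linarith
    have fin : ∀ j, 16 * (1 + |Real.log x|) * (1/x)^j ≤
        16 * Real.exp 2 * 4 * (1 + |Real.log x|) * ((1 + t)/x)^j * Real.exp (-(π/2) * t) := by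
      intro j
      have := B j
      calc _ ≤ 16 * (1 + |Real.log x|) * ((1+t)/x)^j * 1 := by rw [mul_one]; gcongr
        _ ≤ 16 * (1 + |Real.log x|) * ((1+t)/x)^j * (4 * (Real.exp 2 * Real.exp (-(π/2)*t))) := by
          gcongr; linarith
        _ = _ := by ring
    intro j hj
    refine le_trans ((A j).trans ?_) (fin j)
    interval_cases j
    · refine (aux_M0 hx).trans ?_
      simp; linarith
    · refine (aux_M1 hx).trans ?_
      have : 4 / x = 4 * 1 * (1/x) := by ring
      rw [this, pow_one]
      gcongr; norm_num
    · refine (aux_M2 hx).trans ?_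
      have : 16 / x^2 = 16 * 1 * (1/x)^2 := by ring
      rw [this]
      gcongr
  · have ht0 : 0 < t := by linarith
    have hti : 1/t ≤ 1 := by rw [div_le_one ht0]; exact h
    have hti0 : 0 < 1/t := by positivity
    refine ⟨π/2 - 1/t, by linarith, by linarith, ?_⟩
    have hcl : 1 / (2 * t) ≤ Real.cos (π/2 - 1/t) := by
      rw [Real.cos_pi_div_two_sub]
      refine le_trans ?_ (Real.mul_le_sin hti0.le (by linarith))
      have : 1 / (2*t) = (1/2) * (1/t) := by field_simp
      rw [this]
      gcongr ?_ * _
      rw [div_le_div_iff₀ (by norm_num) hpi]; linarith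
    have hc : 0 < Real.cos (π/2 - 1/t) := lt_of_lt_of_le (by positivity) hcl
    have hex : Real.exp (-(t * (π/2 - 1/t))) ≤ Real.exp 2 * Real.exp (-(π/2) * t) := by
      rw [← Real.exp_add]
      gcongr
      have : t * (1/t) = 1 := by field_simp
      nlinarith
    have hinv : 1 / (x * Real.cos (π/2 - 1/t)) ≤ 2 * ((1+t)/x) := by
      calc _ ≤ 1 / (x * (1/(2*t))) := by gcongr
        _ = 2 * (t/x) := by field_simp
        _ ≤ _ := by gcongr; linarith
    have hxc := mul_pos hx hc
    have fin : ∀ j : ℕ, 16 * 4 * ((1+t)/x)^j * (Real.exp 2 * Real.exp (-(π/2)*t)) ≤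
        16 * Real.exp 2 * 4 * (1 + |Real.log x|) * ((1 + t)/x)^j * Real.exp (-(π/2) * t) := by
      intro j
      calc _ = 16 * Real.exp 2 * 4 * 1 * ((1 + t)/x)^j * Real.exp (-(π/2) * t) := by ring
        _ ≤ _ := by gcongr
    intro j hj
    refine le_trans ?_ (fin j)
    interval_cases j
    · refine (J0_ibp ht0 hx hc).trans ?_
      calc _ ≤ (x/t) * ((Real.exp 2 * Real.exp (-(π/2) * t)) * (4 / (x * (1/(2*t))))) := by gcongr
        _ = 8 * (Real.exp 2 * Real.exp (-(π/2) * t)) := by field_simp; norm_num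
        _ ≤ _ := by
          have : 0 < Real.exp 2 * Real.exp (-(π/2) * t) := by positivity
          rw [pow_zero]; linarith
    · refine (norm_JJ_le 1 t hx hc).trans ?_
      have hM := aux_M1 hxc
      calc _ ≤ (Real.exp 2 * Real.exp (-(π/2) * t)) * (4 * (1 / (x * Real.cos (π/2 - 1/t)))) := by
            rw [mul_one_div]; gcongr
        _ ≤ (Real.exp 2 * Real.exp (-(π/2) * t)) * (4 * (2 * ((1+t)/x))) := by gcongr
        _ = 8 * ((1+t)/x)^1 * (Real.exp 2 * Real.exp (-(π/2) * t)) := by ring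
        _ ≤ _ := by gcongr; norm_num
    · refine (norm_JJ_le 2 t hx hc).trans ?_
      have hM := aux_M2 hxc
      calc _ ≤ (Real.exp 2 * Real.exp (-(π/2) * t)) * (16 * (1 / (x * Real.cos (π/2 - 1/t)))^2) := by
            rw [one_div_pow, mul_one_div]; gcongr
        _ ≤ (Real.exp 2 * Real.exp (-(π/2) * t)) * (16 * (2 * ((1+t)/x))^2) := by gcongr
        _ = _ := by ring

/-- Bounds for K_{it}(x) and its first two derivatives in x. -/
theorem stmt17 : ∃ C : ℝ, 0 < C ∧
    ∀ t x : ℝ, 0 < x →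
    DifferentiableAt ℝ (fun y : ℝ => Kit t y) x ∧
    DifferentiableAt ℝ (deriv (fun y : ℝ => Kit t y)) x ∧
    ∀ j : ℕ, j ≤ 2 →
      |iteratedDeriv j (fun y : ℝ => Kit t y) x| ≤
        C * (1 + |Real.log x|) * ((1 + |t|) / x) ^ j * Real.exp (-(π / 2) * |t|) := by
  refine ⟨16 * Real.exp 2 * 4, by positivity, fun t x hx => ?_⟩
  have hK : (fun y : ℝ => Kit t y) = fun y => Kit |t| y := by
    funext y; rw [Kit_abs]
  rw [hK]
  obtain ⟨θ, h0, h1, hb⟩ := main_bound (abs_nonneg t) hx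
  refine ⟨(Kit_deriv |t| hx h0 h1).differentiableAt, (Kit_deriv2 |t| hx h0 h1).differentiableAt,
    fun j hj => ?_⟩
  have hbj := re_half_le (hb j hj)
  interval_cases j
  · rw [iteratedDeriv_zero, Kit_eq |t| hx h0 h1]; exact hbj
  · rw [iteratedDeriv_one, (Kit_deriv |t| hx h0 h1).deriv]; exact hbj
  · rw [iteratedDeriv_succ, iteratedDeriv_one, (Kit_deriv2 |t| hx h0 h1).deriv]; exact hbj
end
end
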